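/- arXiv:1705.02418 — 2 statements merged into one kernel-verified Lean document; each statement's English description precedes it below -/
import Mathlib

section
/- Let G be a simple graph on [0,n] and let d = #E(G) + n (the dimension of the flow polytope F_{G̃}). Then for every positive integer t, the number of integer points in the t-th dilate of F_{G̃} equals (−1)^d · Σ_{i=0}^{d} (−1)^i · ( Σ_{F ⊆ E(G\0), #F = d−i} K_{H_G}(b_G^F) ) · C(t+i, i), where C(t+i,i) is the binomial coefficient. In other words, the Ehrhart polynomial of F_{G̃} is (−1)^d Σ_{i=0}^{d} (−1)^i ( Σ_{F ⊆ E(G\0), #F = d−i} K_{H_G}(b_G^F) ) C(t+i,i). -/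
noncomputable section

open Finset Pointwise

/-- The flow polytope of a directed graph with edge index set `ι`, edges `e` going from
`src e` to `tgt e`, and netflow vector `a`. -/
def flowPolytope {V ι : Type*} [Fintype ι] [DecidableEq V]
    (src tgt : ι → V) (a : V → ℝ) : Set (ι → ℝ) :=
  {f | (∀ e, 0 ≤ f e) ∧
    ∀ v, (∑ e, if src e = v then f e else 0) - (∑ e, if tgt e = v then f e else 0) = a v}

/-- `E(G\0)`: the edges of `G` not incident to the vertex `0`. -/
def EG0 (n : ℕ) (G : Finset (Fin (n + 1) × Fin (n + 1))) :
    Finset (Fin (n + 1) × Fin (n + 1)) :=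
  G.filter fun e => (e.1 : ℕ) ≠ 0

/-- Source map of the graph `H_G` on the vertex set `[n] ∪ {t}` (modeled as
`Option (Fin (n+1))` with `none = t`; the vertex `some 0` is unused): the edges are the
edges `(j,i)` of `G` with `1 ≤ j < i ≤ n` together with one edge `(j,t)` for each
`j ∈ [n]`. -/
def srcH (n : ℕ) (G : Finset (Fin (n + 1) × Fin (n + 1))) :
    (↥(EG0 n G) ⊕ Fin n) → Option (Fin (n + 1))
  | Sum.inl e => some e.1.1
  | Sum.inr i => some i.succ

/-- Target map of `H_G`. -/
def tgtH (n : ℕ) (G : Finset (Fin (n + 1) × Fin (n + 1))) :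
    (↥(EG0 n G) ⊕ Fin n) → Option (Fin (n + 1))
  | Sum.inl e => some e.1.2
  | Sum.inr _ => none

/-- `indeg_G(v)`: number of edges of `G` ending at `v`. -/
def indeg (n : ℕ) (G : Finset (Fin (n + 1) × Fin (n + 1))) (v : Fin (n + 1)) : ℕ :=
  (G.filter fun e => e.2 = v).card

/-- `outdeg_F(v)`: number of edges of `F` starting at `v`. -/
def outdeg (n : ℕ) (F : Finset (Fin (n + 1) × Fin (n + 1))) (v : Fin (n + 1)) : ℕ :=
  (F.filter fun e => e.1 = v).card

/-- The netflow vector `b_G^F = (indeg_G(1) − outdeg_F(1), …, indeg_G(n) − outdeg_F(n),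
−#E(G\F))` on the vertices of `H_G`. -/
def bGF (n : ℕ) (G F : Finset (Fin (n + 1) × Fin (n + 1))) : Option (Fin (n + 1)) → ℝ
  | none => -((G.card : ℝ) - (F.card : ℝ))
  | some v => if v = 0 then 0 else (indeg n G v : ℝ) - (outdeg n F v : ℝ)


/-- The Kostant partition function `K_{H_G}(b_G^F)`: the number of integer points of the
flow polytope of `H_G` with netflow `b_G^F`. -/
def kostH (n : ℕ) (G F : Finset (Fin (n + 1) × Fin (n + 1))) : ℕ :=
  Set.ncard {f | f ∈ flowPolytope (srcH n G) (tgtH n G) (bGF n G F) ∧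
    ∀ e, ∃ z : ℤ, f e = (z : ℝ)}

/-- The vertex `i ∈ [0,n]` viewed inside the vertex set `{s} ∪ [0,n] ∪ {t}` of `G̃`
(modeled as `Fin (n+3)`, with `s = 0` and `t = n+2`). -/
def embedV (n : ℕ) (v : Fin (n + 1)) : Fin (n + 3) := ⟨(v : ℕ) + 1, by omega⟩

/-- Source map of `G̃` : the edges of `G̃` are the edges of `G` together with one edge
`(s,i)` and one edge `(i,t)` for each `i ∈ [0,n]`. -/
def tildeSrc (n : ℕ) (G : Finset (Fin (n + 1) × Fin (n + 1))) :
    (↥G ⊕ Fin (n + 1) ⊕ Fin (n + 1)) → Fin (n + 3)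
  | Sum.inl e => embedV n e.1.1
  | Sum.inr (Sum.inl _) => 0
  | Sum.inr (Sum.inr i) => embedV n i

/-- Target map of `G̃`. -/
def tildeTgt (n : ℕ) (G : Finset (Fin (n + 1) × Fin (n + 1))) :
    (↥G ⊕ Fin (n + 1) ⊕ Fin (n + 1)) → Fin (n + 3)
  | Sum.inl e => embedV n e.1.2
  | Sum.inr (Sum.inl i) => embedV n i
  | Sum.inr (Sum.inr _) => Fin.last (n + 2)

/-- The netflow vector `(1, 0, …, 0, -1)` on the vertices of `G̃`. -/
def tildeNet (n : ℕ) : Fin (n + 3) → ℝ :=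
  fun v => if v = 0 then 1 else if v = Fin.last (n + 2) then -1 else 0

/-- The flow polytope `F_{G̃} = F_{G̃}(1,0,…,0,-1)`. -/
def tildePolytope (n : ℕ) (G : Finset (Fin (n + 1) × Fin (n + 1))) :
    Set ((↥G ⊕ Fin (n + 1) ⊕ Fin (n + 1)) → ℝ) :=
  flowPolytope (tildeSrc n G) (tildeTgt n G) (tildeNet n)

section MultichooseIdentities

open PowerSeries in
theorem mk_multichoose_eq_pow (a : ℕ) :
    (PowerSeries.mk fun k => (a.multichoose k : ℤ)) = (PowerSeries.mk 1) ^ a := by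
  induction a with
  | zero =>
    ext k
    cases k <;> simp [PowerSeries.coeff_one]
  | succ a ih =>
    have h : (PowerSeries.mk fun k => ((a + 1).multichoose k : ℤ)) * (1 - X) =
        PowerSeries.mk fun k => (a.multichoose k : ℤ) := by
      ext k
      cases k with
      | zero => simp [mul_sub]
      | succ k => simp [mul_sub, Nat.multichoose_succ_succ, PowerSeries.coeff_succ_mul_X]
    rw [pow_succ, ← ih, ← h, mul_assoc, mul_comm (1 - X), PowerSeries.mk_one_mul_one_sub_eq_one,
      mul_one]

theorem sum_range_multichoose_mul_multichoose (a b q : ℕ) :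
    ∑ y ∈ range (q + 1), (a.multichoose y : ℤ) * b.multichoose (q - y) =
      (a + b).multichoose q := by
  have h := congrArg (PowerSeries.coeff q)
    (pow_add (PowerSeries.mk (1 : ℕ → ℤ)) a b)
  simp only [← mk_multichoose_eq_pow, PowerSeries.coeff_mul, PowerSeries.coeff_mk] at h
  rw [h, Finset.Nat.sum_antidiagonal_eq_sum_range_succ
    (fun x y => (a.multichoose x : ℤ) * b.multichoose y)]

theorem sum_piAntidiag_prod_multichoose {V : Type*} [Fintype V] [DecidableEq V]
    (c : V → ℕ) (t : ℕ) :
    ∑ p ∈ piAntidiag univ t, ∏ v, ((c v).multichoose (p v) : ℤ) =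
      (∑ v, c v).multichoose t := by
  have h := congrArg (PowerSeries.coeff t)
    (Finset.prod_pow_eq_pow_sum univ c (PowerSeries.mk (1 : ℕ → ℤ)))
  simp only [← mk_multichoose_eq_pow, PowerSeries.coeff_prod, PowerSeries.coeff_mk] at h
  rw [← h]
  refine (sum_bij (fun (l : V →₀ ℕ) _ => (l : V → ℕ)) (fun l hl => ?_)
    (fun l _ l' _ e => DFunLike.coe_injective e)
    (fun p hp => ?_) fun _ _ => rfl).symm
  · simpa using hl
  · exact ⟨Finsupp.equivFunOnFinite.symm p, by simpa using hp, rfl⟩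

/-- The pushed-forward mass in positive degree `p + 1`, resummed over the multiplicities. -/
theorem sum_multichoose_succ_add_mul (a p b q : ℕ) :
    ∑ y ∈ range (q + 1), ((a + 1).multichoose (p + 1 + y) : ℤ) * (b + 1).multichoose (q - y) =
      ∑ y ∈ range (a + 1), ((a + 1 - y).multichoose p : ℤ) * (b + 2 + y).multichoose q := by
  induction p generalizing a with
  | zero =>
    induction a with
    | zero =>
      have h := sum_range_multichoose_mul_multichoose 1 (b + 1) q
      simp only [Nat.multichoose_one, Nat.cast_one, one_mul] at h
      simp [Nat.multichoose_one, h, show 1 + (b + 1) = b + 2 by ring]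
    | succ a ih =>
      have h : ∀ y, (a + 1 + 1).multichoose (0 + 1 + y) =
          (a + 1).multichoose (0 + 1 + y) + (a + 1 + 1).multichoose y := fun y => by
        rw [zero_add, add_comm 1 y, Nat.multichoose_succ_succ]
      simp only [h, Nat.cast_add, add_mul, sum_add_distrib]
      rw [ih, sum_range_multichoose_mul_multichoose, sum_range_succ _ (a + 1)]
      simp only [Nat.multichoose_zero_right]
      rw [show a + 1 + 1 + (b + 1) = b + 2 + (a + 1) by ring, Nat.cast_one, one_mul]
  | succ p ihp =>
    induction a with
    | zero =>
      have h := ihp 0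
      simpa [Nat.multichoose_one] using h
    | succ a iha =>
      have h : ∀ y, (a + 1 + 1).multichoose (p + 1 + 1 + y) =
          (a + 1).multichoose (p + 1 + 1 + y) + (a + 1 + 1).multichoose (p + 1 + y) := fun y => by
        rw [show p + 1 + 1 + y = (p + 1 + y) + 1 by ring, Nat.multichoose_succ_succ]
      simp only [h, Nat.cast_add, add_mul, sum_add_distrib]
      rw [iha, ihp, sum_range_succ _ (a + 1), sum_range_succ _ (a + 1), ← add_assoc,
        ← sum_add_distrib]
      congr 1
      · refine sum_congr rfl fun y hy => ?_
        rw [show a + 1 + 1 - y = (a + 1 - y) + 1 by grind, Nat.multichoose_succ_succ]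
        push_cast
        ring
      · simp [Nat.multichoose_one]

theorem sum_multichoose_add_mul (a p b q : ℕ) :
    ∑ y ∈ range (q + 1), ((a + 1).multichoose (p + y) : ℤ) * (b + 1).multichoose (q - y) =
      ∑ y ∈ range (a + 1), ((a - y + 1).multichoose p : ℤ) * (b + 1 + y + 1).multichoose q -
        ∑ y ∈ range a, ((a - 1 - y + 1).multichoose p : ℤ) * (b + 1 + y + 1).multichoose q := by
  cases p with
  | zero =>
    have h := sum_range_multichoose_mul_multichoose (a + 1) (b + 1) q
    simp only [zero_add, h, sum_range_succ _ a, Nat.multichoose_zero_right]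
    simp only [add_sub_cancel_left, Nat.cast_one, one_mul]
    congr 2
    ring
  | succ p =>
    rw [sum_multichoose_succ_add_mul, sum_range_succ, sum_range_succ, add_sub_right_comm,
      ← sum_sub_distrib]
    congr 1
    · refine sum_congr rfl fun y hy => ?_
      rw [show a + 1 - y = (a - y) + 1 by grind, show a - 1 - y + 1 = a - y by grind,
        Nat.multichoose_succ_succ, show b + 1 + y + 1 = b + 2 + y by ring]
      push_cast
      ring
    · simp [Nat.multichoose_one, show b + 1 + a + 1 = b + 2 + a by ring]

end MultichooseIdentities

section Transfer

variable {V : Type*} [Fintype V] [DecidableEq V]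

/-- `p` with its values at `i` and `j` replaced by `k` and `l`. -/
def setPair (i j : V) (k l : ℕ) (p : V → ℕ) : V → ℕ :=
  Function.update (Function.update p j l) i k

/-- The weight of a supply vector `p` when vertex `v` is supplied through `c v + 1` parallel
edges. -/
def supplyWeight (c p : V → ℕ) : ℤ := ∏ v, ((c v + 1).multichoose (p v) : ℤ)

theorem prod_eq_mul_mul_prod_erase {i j : V} (hij : i ≠ j) (f : V → ℤ) :
    ∏ v, f v = f i * f j * ∏ v ∈ (univ.erase i).erase j, f v := by
  rw [mul_assoc, mul_prod_erase _ f (by simp [hij.symm]), mul_prod_erase _ f (mem_univ i)]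

theorem supplyWeight_setPair_right {i j : V} (hij : i ≠ j) (k l : ℕ) (c p : V → ℕ) :
    supplyWeight c (setPair i j k l p) =
      ((c i + 1).multichoose k : ℤ) * (c j + 1).multichoose l *
        ∏ v ∈ (univ.erase i).erase j, ((c v + 1).multichoose (p v) : ℤ) := by
  rw [supplyWeight, prod_eq_mul_mul_prod_erase hij]
  congr 1
  · simp [setPair, hij.symm]
  · refine prod_congr rfl fun v hv => ?_
    simp only [mem_erase] at hv
    simp [setPair, hv.1, hv.2.1]

theorem supplyWeight_setPair_left {i j : V} (hij : i ≠ j) (k l : ℕ) (c p : V → ℕ) :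
    supplyWeight (setPair i j k l c) p =
      ((k + 1).multichoose (p i) : ℤ) * (l + 1).multichoose (p j) *
        ∏ v ∈ (univ.erase i).erase j, ((c v + 1).multichoose (p v) : ℤ) := by
  rw [supplyWeight, prod_eq_mul_mul_prod_erase hij]
  congr 1
  · simp [setPair, hij.symm]
  · refine prod_congr rfl fun v hv => ?_
    simp only [mem_erase] at hv
    simp [setPair, hv.1, hv.2.1]

theorem sum_supplyWeight_setPair {i j : V} (hij : i ≠ j) (c p : V → ℕ) :
    ∑ y ∈ range (p j + 1), supplyWeight c (setPair i j (p i + y) (p j - y) p) =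
      ∑ y ∈ range (c i + 1), supplyWeight (setPair i j (c i - y) (c j + 1 + y) c) p -
        ∑ y ∈ range (c i), supplyWeight (setPair i j (c i - 1 - y) (c j + 1 + y) c) p := by
  simp only [supplyWeight_setPair_right hij, supplyWeight_setPair_left hij, ← sum_mul, ← sub_mul,
    sum_multichoose_add_mul]

theorem sum_setPair {i j : V} (hij : i ≠ j) (k l : ℕ) (p : V → ℕ) (h : k + l = p i + p j) :
    ∑ v, setPair i j k l p v = ∑ v, p v := by
  rw [← add_sum_erase _ _ (mem_univ i), ← add_sum_erase _ p (mem_univ i),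
    ← add_sum_erase (univ.erase i) _ (show j ∈ _ by simp [hij.symm]),
    ← add_sum_erase (univ.erase i) p (show j ∈ _ by simp [hij.symm]), ← add_assoc, ← add_assoc, ← h]
  congr 1
  · simp [setPair, hij.symm]
  · refine sum_congr rfl fun v hv => ?_
    simp only [mem_erase] at hv
    simp [setPair, hv.1, hv.2.1]

theorem sum_piAntidiag_transfer {i j : V} (hij : i ≠ j) (t : ℕ) (F : (V → ℕ) → (V → ℕ) → ℤ) :
    ∑ p ∈ piAntidiag univ t, ∑ y ∈ range (p i + 1), F p (setPair i j (p i - y) (p j + y) p) =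
      ∑ p ∈ piAntidiag univ t, ∑ y ∈ range (p j + 1), F (setPair i j (p i + y) (p j - y) p) p := by
  rw [sum_sigma', sum_sigma']
  have key : ∀ (a b k l : ℕ) (p : V → ℕ), a = p i → b = p j →
      setPair i j a b (setPair i j k l p) = p := by
    rintro a b k l p rfl rfl
    ext v
    simp only [setPair, Function.update_apply]
    grind
  refine sum_bij' (fun x _ => ⟨setPair i j (x.1 i - x.2) (x.1 j + x.2) x.1, x.2⟩)
    (fun x _ => ⟨setPair i j (x.1 i + x.2) (x.1 j - x.2) x.1, x.2⟩) ?_ ?_ ?_ ?_ ?_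
  · rintro ⟨p, y⟩ h
    simp only [mem_sigma, mem_piAntidiag, mem_range, mem_univ, implies_true, and_true] at h ⊢
    refine ⟨(sum_setPair hij _ _ _ (by omega)).trans h.1, ?_⟩
    simp only [setPair, Function.update_apply, hij.symm, if_false, if_true]
    omega
  · rintro ⟨p, y⟩ h
    simp only [mem_sigma, mem_piAntidiag, mem_range, mem_univ, implies_true, and_true] at h ⊢
    refine ⟨(sum_setPair hij _ _ _ (by omega)).trans h.1, ?_⟩
    simp only [setPair, Function.update_apply, if_true]
    omega
  all_goals
    rintro ⟨p, y⟩ h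
    simp only [mem_sigma, mem_piAntidiag, mem_range] at h
  · refine Sigma.ext (key _ _ _ _ _ ?_ ?_) HEq.rfl <;>
      simp only [setPair, Function.update_apply, hij.symm, if_false, if_true] <;> omega
  · refine Sigma.ext (key _ _ _ _ _ ?_ ?_) HEq.rfl <;>
      simp only [setPair, Function.update_apply, hij.symm, if_false, if_true] <;> omega
  · dsimp only
    rw [key] <;> simp only [setPair, Function.update_apply, hij.symm, if_false, if_true] <;> omega

end Transfer

section FlowCount

variable {V : Type*} [DecidableEq V]

/-- The contribution of a unit of flow on the edge `e` to the net inflow at `v`. -/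
def edgeNet (e : V × V) (v : V) : ℤ := (if e.2 = v then 1 else 0) - (if e.1 = v then 1 else 0)

/-- Integer flows on `G` in which vertex `v` has supply `a v` and may keep any part of what it
receives. -/
def supplyFlows (G : Finset (V × V)) (a : V → ℤ) : Set (V × V → ℕ) :=
  {x | (∀ e ∉ G, x e = 0) ∧ ∀ v, 0 ≤ a v + ∑ e ∈ G, (x e : ℤ) * edgeNet e v}

/-- The number of integer flows on `G` with supply vector `a`. -/
def flowCount (G : Finset (V × V)) (a : V → ℤ) : ℤ := ((supplyFlows G a).ncard : ℤ)

/-- The vector `c + indeg_G - outdeg_F`. -/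
def excessVec (G F : Finset (V × V)) (c : V → ℕ) (v : V) : ℤ :=
  c v + (∑ e ∈ G, if e.2 = v then 1 else 0) - ∑ e ∈ F, if e.1 = v then 1 else 0

theorem supplyFlows_eq_empty {G : Finset (V × V)} {a : V → ℤ} {i : V}
    (hG : ∀ e ∈ G, e.2 ≠ i) (ha : a i < 0) : supplyFlows G a = ∅ := by
  refine Set.eq_empty_of_forall_notMem fun x hx => ?_
  have h : ∑ e ∈ G, (x e : ℤ) * edgeNet e i ≤ 0 := sum_nonpos fun e he => by
    simp only [edgeNet, hG e he, if_false]
    split_ifs <;> simp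
  linarith [hx.2 i]

theorem supplyFlows_insert {G : Finset (V × V)} {e : V × V} (he : e ∉ G)
    (hG : ∀ e' ∈ G, e'.2 ≠ e.1) (hne : e.2 ≠ e.1) (a : V → ℤ) {N : ℕ} (hN : a e.1 < N) :
    supplyFlows (insert e G) a = ⋃ y ∈ (range N : Set ℕ),
      (fun x => Function.update x e y) '' supplyFlows G (fun v => a v + y * edgeNet e v) := by
  have upd : ∀ (x : V × V → ℕ) (k : ℕ) (v : V),
      ∑ e' ∈ G, ((Function.update x e k e' : ℕ) : ℤ) * edgeNet e' v =
        ∑ e' ∈ G, (x e' : ℤ) * edgeNet e' v := fun x k v => by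
    refine sum_congr rfl fun e' he' => ?_
    rw [Function.update_of_ne (ne_of_mem_of_not_mem he' he)]
  ext x
  simp only [Set.mem_iUnion, Set.mem_image, exists_prop, mem_coe, mem_range]
  constructor
  · rintro ⟨h0, h⟩
    simp only [sum_insert he, ← add_assoc] at h
    have hx : Function.update x e 0 ∈ supplyFlows G (fun v => a v + x e * edgeNet e v) := by
      refine ⟨fun e' he' => ?_, fun v => ?_⟩
      · by_cases h' : e' = e
        · simp [h']
        · rw [Function.update_of_ne h']
          exact h0 e' (by simp [h', he'])
      · rw [upd]
        exact h v
    refine ⟨x e, ?_, _, hx, by simp⟩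
    by_contra hlt
    have : supplyFlows G (fun v => a v + x e * edgeNet e v) = ∅ := by
      refine supplyFlows_eq_empty hG ?_
      simp only [edgeNet, hne, if_false, if_true]
      omega
    simp [this] at hx
  · rintro ⟨y, -, x, ⟨h0, h⟩, rfl⟩
    refine ⟨fun e' he' => ?_, fun v => ?_⟩
    · simp only [mem_insert, not_or] at he'
      simp [Function.update_of_ne he'.1, h0 e' he'.2]
    · rw [sum_insert he, upd, ← add_assoc]
      simpa using h v

theorem exists_mem_isSource {V : Type*} [LinearOrder V] {G : Finset (V × V)}
    (hG : ∀ e ∈ G, e.1 < e.2) (hne : G.Nonempty) : ∃ e ∈ G, ∀ e' ∈ G, e'.2 ≠ e.1 := by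
  obtain ⟨e, he, hmin⟩ := exists_min_image G Prod.fst hne
  exact ⟨e, he, fun e' he' => ((hmin e' he').trans_lt (hG e' he')).ne'⟩

/-- Induction on acyclic graphs by removing an edge that starts at a source. -/
theorem acyclic_induction {V : Type*} [LinearOrder V]
    {P : ∀ G : Finset (V × V), (∀ e ∈ G, e.1 < e.2) → Prop}
    (empty : P ∅ (by simp))
    (insert_edge : ∀ (G : Finset (V × V)) (e : V × V) (hG : ∀ e ∈ G, e.1 < e.2), e ∉ G →
      (∀ e' ∈ G, e'.2 ≠ e.1) → (hlt : e.1 < e.2) → P G hG →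
      P (insert e G) ((forall_mem_insert _ _ _).2 ⟨hlt, hG⟩))
    (G : Finset (V × V)) (hG : ∀ e ∈ G, e.1 < e.2) : P G hG := by
  induction G using Finset.strongInduction with
  | H G ih =>
    rcases G.eq_empty_or_nonempty with rfl | hne
    · exact empty
    · obtain ⟨e, he, hsrc⟩ := exists_mem_isSource hG hne
      have hG' : ∀ e' ∈ G.erase e, e'.1 < e'.2 := fun e' he' => hG e' (mem_of_mem_erase he')
      have h := insert_edge _ e hG' (by simp) (fun e' he' => hsrc e' (mem_of_mem_erase he'))
        (hG e he) (ih _ (erase_ssubset he) hG')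
      simpa only [insert_erase he] using h

theorem supplyFlows_finite {V : Type*} [LinearOrder V] {G : Finset (V × V)}
    (hG : ∀ e ∈ G, e.1 < e.2) (a : V → ℤ) : (supplyFlows G a).Finite := by
  induction G, hG using acyclic_induction generalizing a with
  | empty =>
    refine (Set.finite_singleton 0).subset fun x hx => ?_
    ext e
    simpa using hx.1 e
  | insert_edge G e hacyc he hsrc hlt ih =>
    rw [supplyFlows_insert he hsrc hlt.ne' a (N := (a e.1).toNat + 1) (by omega)]
    exact (finite_toSet _).biUnion fun y _ => (ih _).image _

theorem flowCount_insert {V : Type*} [LinearOrder V] {G : Finset (V × V)} {e : V × V}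
    (hacyc : ∀ e ∈ G, e.1 < e.2) (he : e ∉ G)
    (hG : ∀ e' ∈ G, e'.2 ≠ e.1) (hne : e.2 ≠ e.1) (a : V → ℤ) {N : ℕ} (hN : a e.1 < N) :
    flowCount (insert e G) a =
      ∑ y ∈ range N, flowCount G (fun v => a v + y * edgeNet e v) := by
  rw [flowCount, supplyFlows_insert he hG hne a hN, Set.Finite.ncard_biUnion (finite_toSet _)
    (fun y _ => (supplyFlows_finite hacyc _).image _), finsum_mem_coe_finset, Nat.cast_sum]
  · refine sum_congr rfl fun y _ => ?_
    rw [flowCount, Set.InjOn.ncard_image]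
    intro x hx x' hx' h
    ext e'
    by_cases h' : e' = e
    · rw [h', hx.1 e he, hx'.1 e he]
    · simpa [Function.update_of_ne h'] using congrFun h e'
  · intro y _ y' _ hyy
    refine Set.disjoint_left.2 ?_
    rintro _ ⟨x, -, rfl⟩ ⟨x', -, h⟩
    exact hyy (by simpa using (congrFun h e).symm)

theorem flowCount_eq_zero {G : Finset (V × V)} {a : V → ℤ} {i : V}
    (hG : ∀ e ∈ G, e.2 ≠ i) (ha : a i < 0) : flowCount G a = 0 := by
  simp [flowCount, supplyFlows_eq_empty hG ha]

theorem flowCount_empty {a : V → ℤ} (ha : ∀ v, 0 ≤ a v) : flowCount ∅ a = 1 := by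
  have : supplyFlows ∅ a = {0} := by
    ext x
    simp [supplyFlows, ha, funext_iff]
  simp [flowCount, this]

theorem sum_supplyWeight_mul_flowCount {V : Type*} [LinearOrder V] [Fintype V]
    (t : ℕ) {G : Finset (V × V)} (hG : ∀ e ∈ G, e.1 < e.2) (c : V → ℕ) :
    ∑ p ∈ piAntidiag univ t, supplyWeight c p * flowCount G (fun v => p v) =
      ∑ F ∈ G.powerset, (-1) ^ F.card * flowCount G (excessVec G F c) *
        ((∑ v, (c v + 1)) + (G.card - F.card)).multichoose t := by
  induction G, hG using acyclic_induction generalizing c with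
  | empty =>
    have h : flowCount ∅ (excessVec (∅ : Finset (V × V)) ∅ c) = 1 :=
      flowCount_empty fun v => by simp [excessVec]
    rw [powerset_empty, sum_singleton, h]
    simp only [flowCount_empty (a := fun v => ((_ : V → ℕ) v : ℤ)) (fun v => Nat.cast_nonneg _),
      card_empty, pow_zero, one_mul, mul_one, supplyWeight,
      sum_piAntidiag_prod_multichoose (fun v => c v + 1), Nat.sub_zero, add_zero]
  | insert_edge G e hacyc he hsrc hlt ih =>
    obtain ⟨i, j⟩ := e
    dsimp only at hsrc hlt
    have hij : i ≠ j := hlt.ne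
    have split : ∀ p : V → ℕ, flowCount (insert (i, j) G) (fun v => p v) =
        ∑ y ∈ range (p i + 1), flowCount G (fun v => setPair i j (p i - y) (p j + y) p v) := by
      intro p
      rw [flowCount_insert hacyc he hsrc hlt.ne' _ (N := p i + 1) (by push_cast; omega)]
      refine sum_congr rfl fun y hy => congrArg _ (funext fun v => ?_)
      simp only [setPair, edgeNet, Function.update_apply, mem_range] at hy ⊢
      grind
    have without : ∀ F ∈ G.powerset,
        flowCount (insert (i, j) G) (excessVec (insert (i, j) G) F c) =
        ∑ y ∈ range (c i + 1),
          flowCount G (excessVec G F (setPair i j (c i - y) (c j + 1 + y) c)) := by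
      intro F hF
      have hi : (∑ e ∈ G, if e.2 = i then (1 : ℤ) else 0) = 0 :=
        sum_eq_zero fun e' he' => if_neg (hsrc e' he')
      have ho : 0 ≤ ∑ e ∈ F, if e.1 = i then (1 : ℤ) else 0 :=
        sum_nonneg fun e' _ => by split_ifs <;> simp
      rw [flowCount_insert hacyc he hsrc hlt.ne' _ (N := c i + 1)
        (by simp only [excessVec, sum_insert he, hi, hij.symm, if_false]; push_cast; omega)]
      refine sum_congr rfl fun y hy => congrArg _ (funext fun v => ?_)
      simp only [setPair, edgeNet, excessVec, sum_insert he, Function.update_apply,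
        mem_range] at hy ⊢
      grind
    have withEdge : ∀ F ∈ G.powerset,
        flowCount (insert (i, j) G) (excessVec (insert (i, j) G) (insert (i, j) F) c) =
        ∑ y ∈ range (c i),
          flowCount G (excessVec G F (setPair i j (c i - 1 - y) (c j + 1 + y) c)) := by
      intro F hF
      have heF : (i, j) ∉ F := fun h => he (mem_powerset.1 hF h)
      have hi : (∑ e ∈ G, if e.2 = i then (1 : ℤ) else 0) = 0 :=
        sum_eq_zero fun e' he' => if_neg (hsrc e' he')
      have ho : 0 ≤ ∑ e ∈ F, if e.1 = i then (1 : ℤ) else 0 :=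
        sum_nonneg fun e' _ => by split_ifs <;> simp
      rw [flowCount_insert hacyc he hsrc hlt.ne' _ (N := c i)
        (by simp only [excessVec, sum_insert he, sum_insert heF, hi, hij.symm, if_false,
          if_true]; omega)]
      refine sum_congr rfl fun y hy => congrArg _ (funext fun v => ?_)
      simp only [setPair, edgeNet, excessVec, sum_insert he, sum_insert heF,
        Function.update_apply, mem_range] at hy ⊢
      grind
    have size : ∀ y ∈ range (c i + 1), ∑ v, (setPair i j (c i - y) (c j + 1 + y) c v + 1) =
        ∑ v, (c v + 1) + 1 := by
      intro y hy
      have h := sum_setPair hij (c i - y) (c j + 1 + y) (fun v => if v = i then c v + 1 else c v)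
        (by simp only [mem_range] at hy; simp [hij.symm]; omega)
      have h2 : setPair i j (c i - y) (c j + 1 + y) (fun v => if v = i then c v + 1 else c v) =
          setPair i j (c i - y) (c j + 1 + y) c := by
        ext v
        simp only [setPair, Function.update_apply]
        grind
      have h3 : ∀ v, (if v = i then c v + 1 else c v) = c v + if v = i then 1 else 0 := fun v => by
        split_ifs <;> simp
      rw [h2] at h
      simp only [h3, sum_add_distrib, sum_ite_eq', mem_univ, if_true] at h
      simp only [sum_add_distrib, h]
      ring
    have size' : ∀ y ∈ range (c i), ∑ v, (setPair i j (c i - 1 - y) (c j + 1 + y) c v + 1) =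
        ∑ v, (c v + 1) := by
      intro y hy
      simp only [sum_add_distrib]
      rw [sum_setPair hij]
      simp only [mem_range] at hy
      omega
    calc
      _ = ∑ p ∈ piAntidiag univ t, ∑ y ∈ range (p i + 1), supplyWeight c p *
            flowCount G (fun v => setPair i j (p i - y) (p j + y) p v) := by
        simp only [split, mul_sum]
      _ = ∑ y ∈ range (c i + 1), ∑ p ∈ piAntidiag univ t,
            supplyWeight (setPair i j (c i - y) (c j + 1 + y) c) p *
              flowCount G (fun v => p v) -
          ∑ y ∈ range (c i), ∑ p ∈ piAntidiag univ t,
            supplyWeight (setPair i j (c i - 1 - y) (c j + 1 + y) c) p *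
              flowCount G (fun v => p v) := by
        rw [sum_piAntidiag_transfer hij t
          (fun p p' => supplyWeight c p * flowCount G (fun v => p' v))]
        simp only [← sum_mul, sum_supplyWeight_setPair hij]
        simp only [sub_mul, sum_mul, sum_sub_distrib]
        rw [sum_comm, sum_comm (s := range (c i))]
      _ = _ := by
        simp only [ih]
        rw [sum_powerset_insert he, sub_eq_add_neg]
        congr 1
        · rw [sum_comm]
          refine sum_congr rfl fun F hF => ?_
          have hcard := card_le_card (mem_powerset.1 hF)
          rw [without F hF, mul_sum, sum_mul, card_insert_of_notMem he]
          refine sum_congr rfl fun y hy => ?_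
          rw [size y hy, show ∑ v, (c v + 1) + 1 + (G.card - F.card) =
            ∑ v, (c v + 1) + (G.card + 1 - F.card) by omega]
        · rw [sum_comm, ← sum_neg_distrib]
          refine sum_congr rfl fun F hF => ?_
          have heF : (i, j) ∉ F := fun h => he (mem_powerset.1 hF h)
          rw [withEdge F hF, mul_sum, sum_mul, ← sum_neg_distrib, card_insert_of_notMem he,
            card_insert_of_notMem heF]
          refine sum_congr rfl fun y hy => ?_
          rw [size' y hy, Nat.add_sub_add_right]
          ring

end FlowCount

section LatticePoints

theorem sum_edgeNet {V : Type*} [Fintype V] [DecidableEq V] (e : V × V) :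
    ∑ v, edgeNet e v = 0 := by
  simp [edgeNet]

theorem sum_sum_mul_edgeNet {V ι : Type*} [Fintype V] [DecidableEq V] [Fintype ι]
    (g : ι → ℝ) (e : ι → V × V) : ∑ v, ∑ k, g k * (edgeNet (e k) v : ℝ) = 0 := by
  rw [sum_comm]
  refine sum_eq_zero fun k _ => ?_
  rw [← mul_sum, ← Int.cast_sum, sum_edgeNet, Int.cast_zero, mul_zero]

theorem sum_coe_mul_edgeNet {V : Type*} [DecidableEq V] (G : Finset (V × V)) (x : V × V → ℕ)
    (v : V) : ∑ e : G, (x e : ℝ) * (edgeNet e.1 v : ℝ) =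
      ((∑ e ∈ G, (x e : ℤ) * edgeNet e v : ℤ) : ℝ) := by
  push_cast
  exact sum_coe_sort G fun e => (x e : ℝ) * (edgeNet e v : ℝ)

theorem sum_mul_edgeNet_eq {V ι : Type*} [DecidableEq V] [Fintype ι]
    (g : ι → ℝ) (e : ι → V × V) (v : V) :
    ∑ k, g k * (edgeNet (e k) v : ℝ) =
      (∑ k, if (e k).2 = v then g k else 0) - ∑ k, if (e k).1 = v then g k else 0 := by
  rw [← sum_sub_distrib]
  refine sum_congr rfl fun k _ => ?_
  simp only [edgeNet]
  split_ifs <;> simp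

theorem natFloor_cast_eq {r : ℝ} (h0 : 0 ≤ r) (hz : ∃ z : ℤ, r = z) : (⌊r⌋₊ : ℝ) = r := by
  obtain ⟨z, rfl⟩ := hz
  lift z to ℕ using by exact_mod_cast h0
  simp

theorem smul_flowPolytope {V ι : Type*} [Fintype ι] [DecidableEq V] (src tgt : ι → V)
    (a : V → ℝ) {r : ℝ} (hr : 0 < r) :
    r • flowPolytope src tgt a = flowPolytope src tgt (fun v => r * a v) := by
  ext f
  rw [Set.mem_smul_set_iff_inv_smul_mem₀ hr.ne']
  simp only [flowPolytope, Set.mem_ofPred_eq, Pi.smul_apply, smul_eq_mul]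
  refine and_congr (forall_congr' fun e => ?_) (forall_congr' fun v => ?_)
  · rw [mul_nonneg_iff_of_pos_left (inv_pos.2 hr)]
  · simp only [← mul_ite_zero, ← mul_sum, ← mul_sub]
    rw [inv_mul_eq_iff_eq_mul₀ hr.ne']

variable {n : ℕ}

theorem embedV_ne_zero (i : Fin (n + 1)) : embedV n i ≠ 0 :=
  Fin.ne_of_val_ne (by simp [embedV])

theorem embedV_ne_last (i : Fin (n + 1)) : embedV n i ≠ Fin.last (n + 2) := by
  simp only [embedV, ne_eq, Fin.ext_iff, Fin.val_last]
  omega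

theorem embedV_inj {i j : Fin (n + 1)} : embedV n i = embedV n j ↔ i = j := by
  simp [embedV, Fin.ext_iff]

theorem eq_zero_or_embedV_or_last (v : Fin (n + 3)) :
    v = 0 ∨ (∃ i, v = embedV n i) ∨ v = Fin.last (n + 2) := by
  simp only [embedV, Fin.ext_iff, Fin.val_last, Fin.val_zero]
  by_cases h0 : (v : ℕ) = 0
  · exact Or.inl h0
  by_cases h1 : (v : ℕ) = n + 2
  · exact Or.inr (Or.inr h1)
  · exact Or.inr (Or.inl ⟨⟨v - 1, by omega⟩, by dsimp only; omega⟩)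

theorem mem_tilde_iff {G : Finset (Fin (n + 1) × Fin (n + 1))} {r : ℝ}
    {f : (↥G ⊕ Fin (n + 1) ⊕ Fin (n + 1)) → ℝ} :
    f ∈ flowPolytope (tildeSrc n G) (tildeTgt n G) (fun v => r * tildeNet n v) ↔
      (∀ e, 0 ≤ f e) ∧ ∑ i, f (Sum.inr (Sum.inl i)) = r ∧
        ∀ i, f (Sum.inr (Sum.inr i)) =
          f (Sum.inr (Sum.inl i)) + ∑ e : G, f (Sum.inl e) * (edgeNet e.1 i : ℝ) := by
  have hmid : ∀ i, (∑ e, if tildeSrc n G e = embedV n i then f e else 0) -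
      (∑ e, if tildeTgt n G e = embedV n i then f e else 0) = f (Sum.inr (Sum.inr i)) -
      (f (Sum.inr (Sum.inl i)) + ∑ e : G, f (Sum.inl e) * (edgeNet e.1 i : ℝ)) := fun i => by
    simp only [Fintype.sum_sum_type, tildeSrc, tildeTgt, embedV_inj, (embedV_ne_zero i).symm,
      (embedV_ne_last i).symm, if_false, sum_mul_edgeNet_eq (fun e : G => f (Sum.inl e))]
    simp
    ring
  have hs : (∑ e, if tildeSrc n G e = 0 then f e else 0) -
      (∑ e, if tildeTgt n G e = 0 then f e else 0) = ∑ i, f (Sum.inr (Sum.inl i)) := by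
    simp [Fintype.sum_sum_type, tildeSrc, tildeTgt, embedV_ne_zero]
  have ht : (∑ e, if tildeSrc n G e = Fin.last (n + 2) then f e else 0) -
      (∑ e, if tildeTgt n G e = Fin.last (n + 2) then f e else 0) =
      -∑ i, f (Sum.inr (Sum.inr i)) := by
    have : (0 : Fin (n + 3)) ≠ Fin.last (n + 2) := by simp [Fin.ext_iff]
    simp [Fintype.sum_sum_type, tildeSrc, tildeTgt, embedV_ne_last, this]
  have nets : tildeNet n (Fin.last (n + 2)) = -1 := by simp [tildeNet, Fin.ext_iff]
  refine and_congr_right fun _ => ⟨fun h => ⟨?_, fun i => ?_⟩, ?_⟩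
  · rw [← hs, h 0]
    simp [tildeNet]
  · have := h (embedV n i)
    rw [hmid] at this
    simpa [tildeNet, embedV_ne_zero, embedV_ne_last, sub_eq_zero] using this
  · rintro ⟨h0, h⟩ v
    rcases eq_zero_or_embedV_or_last v with rfl | ⟨i, rfl⟩ | rfl
    · rw [hs, h0]
      simp [tildeNet]
    · rw [hmid, h i]
      simp [tildeNet, embedV_ne_zero, embedV_ne_last]
    · rw [ht]
      simp only [nets, h, sum_add_distrib, h0,
        sum_sum_mul_edgeNet (fun e : G => f (Sum.inl e)) (fun e : G => e.1)]
      ring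

theorem ncard_smul_tildePolytope {G : Finset (Fin (n + 1) × Fin (n + 1))}
    (hG : ∀ e ∈ G, e.1 < e.2) {t : ℕ} (ht : 0 < t) :
    (Set.ncard {f | f ∈ (t : ℝ) • tildePolytope n G ∧ ∀ e, ∃ z : ℤ, f e = (z : ℝ)} : ℤ) =
      ∑ p ∈ piAntidiag univ t, flowCount G (fun v => (p v : ℤ)) := by
  have hT : ((⋃ p ∈ ((piAntidiag univ t : Finset (Fin (n + 1) → ℕ)) : Set (Fin (n + 1) → ℕ)),
      Prod.mk p '' supplyFlows G (fun v => (p v : ℤ))).ncard : ℤ) =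
      ∑ p ∈ piAntidiag univ t, flowCount G (fun v => (p v : ℤ)) := by
    rw [Set.Finite.ncard_biUnion (finite_toSet _) (fun p _ => (supplyFlows_finite hG _).image _),
      finsum_mem_coe_finset, Nat.cast_sum]
    · refine sum_congr rfl fun p _ => ?_
      rw [flowCount, Set.ncard_image_of_injective _ (Prod.mk_right_injective p)]
    · intro p _ p' _ hpp
      refine Set.disjoint_left.2 ?_
      rintro _ ⟨x, -, rfl⟩ ⟨x', -, h⟩
      exact hpp (congrArg Prod.fst h).symm
  rw [← hT, Nat.cast_inj, tildePolytope, smul_flowPolytope _ _ _ (by exact_mod_cast ht)]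
  symm
  refine Set.ncard_congr (fun y _ => Sum.elim (fun e : G => (y.2 e : ℝ)) (Sum.elim
    (fun i => (y.1 i : ℝ))
    (fun i => ((y.1 i + ∑ e ∈ G, (y.2 e : ℤ) * edgeNet e i : ℤ) : ℝ)))) ?_ ?_ ?_
  · rintro ⟨p, x⟩ h
    simp only [Set.mem_iUnion, Set.mem_image, exists_prop, mem_coe, mem_piAntidiag,
      Prod.mk.injEq] at h
    obtain ⟨p, hp, x, hx, rfl, rfl⟩ := h
    refine ⟨mem_tilde_iff.2 ⟨?_, ?_, ?_⟩, ?_⟩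
    · rintro (e | i | i)
      · simp
      · simp
      · simpa only [Sum.elim_inr, Int.cast_nonneg_iff] using hx.2 i
    · simpa using congrArg (Nat.cast (R := ℝ)) hp.1
    · intro i
      simp only [Sum.elim_inr, Sum.elim_inl, sum_coe_mul_edgeNet G x]
      push_cast
      rfl
    · rintro (e | i | i)
      · exact ⟨x e, by simp⟩
      · exact ⟨p i, by simp⟩
      · exact ⟨_, rfl⟩
  · rintro ⟨p, x⟩ ⟨p', x'⟩ h h' heq
    simp only [Set.mem_iUnion, Set.mem_image, exists_prop, mem_coe, Prod.mk.injEq] at h h'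
    obtain ⟨p, hp, x, hx, rfl, rfl⟩ := h
    obtain ⟨p', hp', x', hx', rfl, rfl⟩ := h'
    refine Prod.ext (funext fun i => ?_) (funext fun e => ?_)
    · simpa using congrFun heq (Sum.inr (Sum.inl i))
    · by_cases he : e ∈ G
      · simpa using congrFun heq (Sum.inl ⟨e, he⟩)
      · exact (hx.1 e he).trans (hx'.1 e he).symm
  · rintro f ⟨hf, hz⟩
    obtain ⟨h0, hsum, hq⟩ := mem_tilde_iff.1 hf
    have hfl : ∀ e, (⌊f e⌋₊ : ℝ) = f e := fun e => natFloor_cast_eq (h0 e) (hz e)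
    set p : Fin (n + 1) → ℕ := fun i => ⌊f (Sum.inr (Sum.inl i))⌋₊
    set x : Fin (n + 1) × Fin (n + 1) → ℕ :=
      fun e => if h : e ∈ G then ⌊f (Sum.inl ⟨e, h⟩)⌋₊ else 0 with hx
    have hxe : ∀ e : G, (x e : ℝ) = f (Sum.inl e) := fun e => by simp [hx, hfl]
    have hpi : ∀ i, (p i : ℝ) = f (Sum.inr (Sum.inl i)) := fun i => hfl _
    have hout : ∀ i, ((p i + ∑ e ∈ G, (x e : ℤ) * edgeNet e i : ℤ) : ℝ) =
        f (Sum.inr (Sum.inr i)) := fun i => by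
      rw [Int.cast_add, ← sum_coe_mul_edgeNet, hq i]
      simp only [hxe, Int.cast_natCast, hpi]
    refine ⟨(p, x), ?_, ?_⟩
    · simp only [Set.mem_iUnion, Set.mem_image, exists_prop, mem_coe, mem_piAntidiag]
      refine ⟨p, ⟨?_, by simp⟩, x, ⟨fun e he => by simp [hx, he], fun i => ?_⟩, rfl⟩
      · have : ((∑ i, p i : ℕ) : ℝ) = t := by
          push_cast
          simp only [hpi, hsum]
        exact_mod_cast this
      · have := h0 (Sum.inr (Sum.inr i))
        rw [← hout i] at this
        exact_mod_cast this
    · ext (e | i | i)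
      · exact hxe e
      · exact hpi i
      · exact hout i


theorem snd_ne_zero_of_mem {G : Finset (Fin (n + 1) × Fin (n + 1))} (hG : ∀ e ∈ G, e.1 < e.2) :
    ∀ e ∈ G, e.2 ≠ 0 := fun e he => (Fin.zero_le _ |>.trans_lt (hG e he)).ne'

theorem mem_EG0 {G : Finset (Fin (n + 1) × Fin (n + 1))} {e : Fin (n + 1) × Fin (n + 1)} :
    e ∈ EG0 n G ↔ e ∈ G ∧ e.1 ≠ 0 := by
  rw [EG0, mem_filter, ne_eq, Fin.val_eq_zero_iff]

theorem supplyFlows_EG0 {G : Finset (Fin (n + 1) × Fin (n + 1))} (hG : ∀ e ∈ G, e.1 < e.2)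
    {a : Fin (n + 1) → ℤ} (ha : a 0 = 0) : supplyFlows G a = supplyFlows (EG0 n G) a := by
  have hsub : EG0 n G ⊆ G := filter_subset _ _
  have hsum : ∀ x : Fin (n + 1) × Fin (n + 1) → ℕ, (∀ e ∉ EG0 n G, x e = 0) → ∀ v,
      ∑ e ∈ EG0 n G, (x e : ℤ) * edgeNet e v = ∑ e ∈ G, (x e : ℤ) * edgeNet e v :=
    fun x hx v => sum_subset hsub fun e _ he => by simp [hx e he]
  ext x
  constructor
  · rintro ⟨h0, h⟩
    have hx : ∀ e ∉ EG0 n G, x e = 0 := by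
      intro e he
      by_cases heG : e ∈ G
      · have he0 : e.1 = 0 := by simpa [mem_EG0, heG] using he
        have hterm : ∀ e ∈ G, (x e : ℤ) * edgeNet e 0 ≤ 0 := fun e' he' => by
          simp only [edgeNet, snd_ne_zero_of_mem hG e' he', if_false]
          split_ifs <;> simp
        have hle := h 0
        rw [ha, zero_add] at hle
        have hzero := (sum_eq_zero_iff_of_nonpos hterm).1 ((sum_nonpos hterm).antisymm hle) e heG
        simpa [edgeNet, he0, snd_ne_zero_of_mem hG e heG] using hzero
      · exact h0 e heG
    exact ⟨hx, fun v => by rw [hsum x hx]; exact h v⟩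
  · rintro ⟨h0, h⟩
    exact ⟨fun e he => h0 e fun he' => he (hsub he'), fun v => by rw [← hsum x h0]; exact h v⟩

theorem sum_excessVec {V : Type*} [Fintype V] [DecidableEq V] (G F : Finset (V × V)) :
    ∑ v, excessVec G F 0 v = (G.card : ℤ) - F.card := by
  simp only [excessVec, Pi.zero_apply, Nat.cast_zero, zero_add, sum_sub_distrib]
  rw [sum_comm, sum_comm (s := univ) (t := F)]
  simp

theorem excessVec_zero_eq {G F : Finset (Fin (n + 1) × Fin (n + 1))} (v : Fin (n + 1)) :
    excessVec G F 0 v = (indeg n G v : ℤ) - outdeg n F v := by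
  simp [excessVec, indeg, outdeg]

theorem excessVec_source {G F : Finset (Fin (n + 1) × Fin (n + 1))} (hG : ∀ e ∈ G, e.1 < e.2)
    (hF : F ⊆ EG0 n G) : excessVec G F 0 0 = 0 := by
  simp only [excessVec, Pi.zero_apply]
  rw [sum_eq_zero fun e he => if_neg (snd_ne_zero_of_mem hG e he),
    sum_eq_zero fun e he => if_neg (mem_EG0.1 (hF he)).2]
  simp

theorem mem_flowPolytope_H_iff {G F : Finset (Fin (n + 1) × Fin (n + 1))}
    (hG : ∀ e ∈ G, e.1 < e.2) (hF : F ⊆ EG0 n G) {f : ↥(EG0 n G) ⊕ Fin n → ℝ} :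
    f ∈ flowPolytope (srcH n G) (tgtH n G) (bGF n G F) ↔
      (∀ e, 0 ≤ f e) ∧ ∀ i : Fin n, f (Sum.inr i) = excessVec G F 0 i.succ +
        ∑ e : EG0 n G, f (Sum.inl e) * (edgeNet e.1 i.succ : ℝ) := by
  have hmid : ∀ i : Fin n, (∑ e, if srcH n G e = some i.succ then f e else 0) -
      (∑ e, if tgtH n G e = some i.succ then f e else 0) = f (Sum.inr i) -
      ∑ e : EG0 n G, f (Sum.inl e) * (edgeNet e.1 i.succ : ℝ) := fun i => by
    rw [sum_mul_edgeNet_eq (fun e : EG0 n G => f (Sum.inl e)) (fun e => e.1)]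
    simp [Fintype.sum_sum_type, srcH, tgtH]
    ring
  have h0 : ∀ e : EG0 n G, e.1.1 ≠ 0 ∧ e.1.2 ≠ 0 := fun e =>
    ⟨(mem_EG0.1 e.2).2, snd_ne_zero_of_mem hG _ (mem_EG0.1 e.2).1⟩
  have hzero : (∑ e, if srcH n G e = some 0 then f e else 0) -
      (∑ e, if tgtH n G e = some 0 then f e else 0) = 0 := by
    simp [Fintype.sum_sum_type, srcH, tgtH, h0]
  have hnone : (∑ e, if srcH n G e = none then f e else 0) -
      (∑ e, if tgtH n G e = none then f e else 0) = -∑ i, f (Sum.inr i) := by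
    simp [Fintype.sum_sum_type, srcH, tgtH]
  have hb : ∀ i : Fin n, bGF n G F (some i.succ) = excessVec G F 0 i.succ := fun i => by
    simp [bGF, excessVec_zero_eq]
  refine and_congr_right fun _ => ⟨fun h i => ?_, fun h v => ?_⟩
  · have := h (some i.succ)
    rw [hmid, hb] at this
    linarith
  · rcases v with _ | v
    · have hexc := congrArg (Int.cast (R := ℝ)) (sum_excessVec G F)
      have hnet := sum_sum_mul_edgeNet (fun e : EG0 n G => f (Sum.inl e)) (fun e => e.1)
      have hnet0 : ∑ e : EG0 n G, f (Sum.inl e) * (edgeNet e.1 0 : ℝ) = 0 :=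
        sum_eq_zero fun e _ => by simp [edgeNet, h0]
      rw [Fin.sum_univ_succ, hnet0, zero_add] at hnet
      rw [Fin.sum_univ_succ, excessVec_source hG hF, zero_add] at hexc
      push_cast at hexc
      rw [hnone]
      simp only [h, sum_add_distrib, hnet, hexc, bGF, add_zero]
    · rcases Fin.eq_zero_or_eq_succ v with rfl | ⟨i, rfl⟩
      · rw [hzero]
        simp [bGF]
      · rw [hmid, hb, h i]
        ring

theorem kostH_eq_flowCount {G F : Finset (Fin (n + 1) × Fin (n + 1))}
    (hG : ∀ e ∈ G, e.1 < e.2) (hF : F ⊆ EG0 n G) :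
    (kostH n G F : ℤ) = flowCount G (excessVec G F 0) := by
  rw [kostH, flowCount, supplyFlows_EG0 hG (excessVec_source hG hF), Nat.cast_inj]
  symm
  refine Set.ncard_congr (fun x _ => Sum.elim (fun e : EG0 n G => (x e : ℝ))
    (fun i : Fin n => ((excessVec G F 0 i.succ +
      ∑ e ∈ EG0 n G, (x e : ℤ) * edgeNet e i.succ : ℤ) : ℝ))) ?_ ?_ ?_
  · rintro x hx
    refine ⟨(mem_flowPolytope_H_iff hG hF).2 ⟨?_, ?_⟩, ?_⟩
    · rintro (e | i)
      · simp
      · simpa only [Sum.elim_inr, Int.cast_nonneg_iff] using hx.2 i.succ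
    · intro i
      simp only [Sum.elim_inr, Sum.elim_inl, sum_coe_mul_edgeNet (EG0 n G) x]
      push_cast
      rfl
    · rintro (e | i)
      · exact ⟨x e, by simp⟩
      · exact ⟨_, rfl⟩
  · intro x x' hx hx' heq
    ext e
    by_cases he : e ∈ EG0 n G
    · simpa using congrFun heq (Sum.inl ⟨e, he⟩)
    · exact (hx.1 e he).trans (hx'.1 e he).symm
  · rintro f ⟨hf, hz⟩
    obtain ⟨h0, hq⟩ := (mem_flowPolytope_H_iff hG hF).1 hf
    have hfl : ∀ e, (⌊f e⌋₊ : ℝ) = f e := fun e => natFloor_cast_eq (h0 e) (hz e)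
    set x : Fin (n + 1) × Fin (n + 1) → ℕ :=
      fun e => if h : e ∈ EG0 n G then ⌊f (Sum.inl ⟨e, h⟩)⌋₊ else 0 with hx
    have hxe : ∀ e : EG0 n G, (x e : ℝ) = f (Sum.inl e) := fun e => by simp [hx, hfl]
    have hout : ∀ i : Fin n, ((excessVec G F 0 i.succ +
        ∑ e ∈ EG0 n G, (x e : ℤ) * edgeNet e i.succ : ℤ) : ℝ) = f (Sum.inr i) := fun i => by
      rw [Int.cast_add, ← sum_coe_mul_edgeNet, hq i]
      simp only [hxe]
    refine ⟨x, ⟨fun e he => by simp [hx, he], fun v => ?_⟩, ?_⟩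
    · rcases Fin.eq_zero_or_eq_succ v with rfl | ⟨i, rfl⟩
      · rw [excessVec_source hG hF, zero_add]
        refine (sum_eq_zero fun e he => ?_).ge
        rw [mem_EG0] at he
        simp [edgeNet, he.2, snd_ne_zero_of_mem hG e he.1]
      · have := h0 (Sum.inr i)
        rw [← hout i] at this
        exact_mod_cast this
    · ext (e | i)
      · exact hxe e
      · exact hout i

theorem flowCount_excessVec_eq_zero {G F : Finset (Fin (n + 1) × Fin (n + 1))}
    (hG : ∀ e ∈ G, e.1 < e.2) (hF : F ⊆ G) (hF0 : ¬F ⊆ EG0 n G) :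
    flowCount G (excessVec G F 0) = 0 := by
  obtain ⟨e, he, he0⟩ := not_subset.1 hF0
  have he1 : e.1 = 0 := by simpa [mem_EG0, hF he] using he0
  refine flowCount_eq_zero (snd_ne_zero_of_mem hG) ?_
  have hpos : 0 < ∑ e ∈ F, if e.1 = 0 then (1 : ℤ) else 0 :=
    sum_pos' (fun e _ => by split_ifs <;> simp) ⟨e, he, by simp [he1]⟩
  simp only [excessVec, Pi.zero_apply]
  rw [sum_eq_zero fun e he => if_neg (snd_ne_zero_of_mem hG e he)]
  simpa using hpos

end LatticePoints

/-- Theorem: the Ehrhart polynomial of `F_{G̃}`.  Let `G` be a simple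
graph on `[0,n]` and `d = #E(G) + n` (the dimension of `F_{G̃}`).  Then for every positive
integer `t`, the number of integer points of the `t`-th dilate of `F_{G̃}` equals
`(−1)^d ∑_{i=0}^{d} (−1)^i (∑_{F ⊆ E(G\0), #F = d−i} K_{H_G}(b_G^F)) C(t+i, i)`. -/
theorem ehrhart_tilde (n : ℕ) (G : Finset (Fin (n + 1) × Fin (n + 1)))
    (hG : ∀ e ∈ G, e.1 < e.2) :
    ∀ t : ℕ, 0 < t →
      (Set.ncard {f | f ∈ (t : ℝ) • tildePolytope n G ∧ ∀ e, ∃ z : ℤ, f e = (z : ℝ)} : ℤ) =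
        (-1 : ℤ) ^ (G.card + n) *
          ∑ i ∈ Finset.range (G.card + n + 1),
            (-1 : ℤ) ^ i *
              (∑ F ∈ (EG0 n G).powerset.filter (fun F => F.card = G.card + n - i),
                (kostH n G F : ℤ)) *
              ((t + i).choose i : ℤ) := by

  intro t ht
  rw [ncard_smul_tildePolytope hG ht]
  have h := sum_supplyWeight_mul_flowCount t hG 0
  simp only [supplyWeight, Pi.zero_apply, zero_add, Nat.multichoose_one, Nat.cast_one,
    prod_const_one, one_mul, sum_const, card_univ, Fintype.card_fin, smul_eq_mul, mul_one] at h
  have hsub : (EG0 n G).powerset ⊆ G.powerset := powerset_mono.2 (filter_subset _ _)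
  rw [h, ← sum_subset hsub fun F hF hF0 => by
    rw [flowCount_excessVec_eq_zero hG (mem_powerset.1 hF) (by simpa using hF0), mul_zero,
      zero_mul]]
  have hcard : ∀ F ∈ (EG0 n G).powerset, F.card ≤ G.card := fun F hF =>
    card_le_card (mem_powerset.1 (hsub hF))
  rw [← sum_fiberwise_of_maps_to (t := range (G.card + n + 1))
    (g := fun F => G.card + n - F.card) (fun F hF => by simp only [mem_range]; omega), mul_sum]
  refine sum_congr rfl fun i hi => ?_
  have hi' : i ≤ G.card + n := by simpa [Nat.lt_succ_iff] using hi
  have hfilter : (EG0 n G).powerset.filter (fun F => G.card + n - F.card = i) =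
      (EG0 n G).powerset.filter (fun F => F.card = G.card + n - i) :=
    filter_congr fun F hF => by
      have := hcard F hF
      omega
  rw [hfilter, mul_sum, sum_mul, mul_sum]
  refine sum_congr rfl fun F hF => ?_
  rw [mem_filter] at hF
  have hFG := hcard F hF.1
  rw [kostH_eq_flowCount hG (mem_powerset.1 hF.1), Nat.multichoose_eq,
    show n + 1 + (G.card - F.card) + t - 1 = t + i by omega,
    show (t + i).choose t = (t + i).choose i from Nat.choose_symm_add,
    show (-1 : ℤ) ^ F.card = (-1) ^ (G.card + n) * (-1) ^ i by
      rw [← pow_add, show G.card + n + i = F.card + 2 * i by omega, pow_add, pow_mul]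
      simp]
  ring
end
end

section
/- Let π ∈ S_{n+1} be of the form π = 1π', where π' is a dominant permutation of {2,...,n+1}. Then the Grothendieck polynomial 𝔊_π ∈ ℤ[x_1,...,x_n] has polytopal support: a lattice point α lies in Newton(𝔊_π) if and only if the monomial x^α appears in 𝔊_π with nonzero coefficient (so 𝔊_π is a weighted integer-point transform of its Newton polytope with all weights nonzero). Moreover, for every k ≥ 0, the homogeneous component of 𝔊_π of degree ℓ(π) + k has polytopal support and its Newton polytope is a generalized permutahedron, where ℓ(π) is the number of inversions of π. -/
noncomputable section

open MvPolynomial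

/-- `Gr` is the family of Grothendieck polynomials of `S_{n+1}` (permutations of
`{1,…,n+1}`, 0-indexed as `Equiv.Perm (Fin (n+1))`; the variable `X i` stands for
`x_{i+1}`): `Gr w₀ = x_1^n x_2^{n-1} ⋯ x_n` for the longest element `w₀`, and
`Gr w = π_i Gr_{w sᵢ}` whenever `w(i) < w(i+1)`, where `π_i f = ∂_i((1 − x_{i+1}) f)`,
the latter written in the equivalent denominator-free form
`(x_i − x_{i+1}) · Gr w = g − sᵢ · g` with `g = (1 − x_{i+1}) · Gr_{w sᵢ}`. -/
def IsGrothendieckFamily (n : ℕ)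
    (Gr : Equiv.Perm (Fin (n + 1)) → MvPolynomial (Fin (n + 1)) ℤ) : Prop :=
  Gr Fin.revPerm = ∏ i : Fin (n + 1), X i ^ (n - (i : ℕ)) ∧
  ∀ (w : Equiv.Perm (Fin (n + 1))) (i : Fin n), w i.castSucc < w i.succ →
    (X i.castSucc - X i.succ) * Gr w =
      (1 - X i.succ) * Gr (w * Equiv.swap i.castSucc i.succ) -
        rename (Equiv.swap i.castSucc i.succ)
          ((1 - X i.succ) * Gr (w * Equiv.swap i.castSucc i.succ))

/-- The Newton polytope of a polynomial: the convex hull of its exponent vectors. -/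
def newtonPolytope {N : ℕ} (f : MvPolynomial (Fin N) ℤ) : Set (Fin N → ℝ) :=
  convexHull ℝ {v | ∃ d ∈ f.support, v = fun i => ((d i : ℕ) : ℝ)}

/-- A polynomial has polytopal support if every lattice point of its Newton polytope is
the exponent vector of a monomial with nonzero coefficient. -/
def HasPolytopalSupport {N : ℕ} (f : MvPolynomial (Fin N) ℤ) : Prop :=
  ∀ α : Fin N →₀ ℕ,
    ((fun i => ((α i : ℕ) : ℝ)) ∈ newtonPolytope f ↔ coeff α f ≠ 0)

/-- A generalized permutahedron: a set of the form
`{ x : ∑_{i∈I} x_i ≥ z_I for proper I, ∑ x_i = z_{[N]} }` for a supermodular family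
`z` with `z_∅ = 0`. -/
def IsGenPermutahedron {N : ℕ} (P : Set (Fin N → ℝ)) : Prop :=
  ∃ z : Finset (Fin N) → ℝ, z ∅ = 0 ∧
    (∀ I J : Finset (Fin N), z I + z J ≤ z (I ∪ J) + z (I ∩ J)) ∧
    P = {x | (∀ I : Finset (Fin N), I ≠ Finset.univ → z I ≤ ∑ i ∈ I, x i) ∧
      ∑ i, x i = z Finset.univ}

/-- The number of inversions (Coxeter length) of a permutation. -/
def invCount (n : ℕ) (π : Equiv.Perm (Fin (n + 1))) : ℕ :=
  (Finset.univ.filter fun p : Fin (n + 1) × Fin (n + 1) => p.1 < p.2 ∧ π p.2 < π p.1).card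

/-- A set of integer vectors is M-convex if it satisfies the simultaneous exchange property. -/
def MConvex {ι : Type*} [DecidableEq ι] (S : Set (ι → ℤ)) : Prop :=
  ∀ x ∈ S, ∀ y ∈ S, ∀ i, y i < x i → ∃ j, x j < y j ∧
    x - Pi.single i 1 + Pi.single j 1 ∈ S ∧ y + Pi.single i 1 - Pi.single j 1 ∈ S

namespace MConvex

variable {ι : Type*} [DecidableEq ι] {S : Set (ι → ℤ)}

lemma translate (hS : MConvex S) (a : ι → ℤ) : MConvex {x | x + a ∈ S} := by
  intro x hx y hy i hi
  obtain ⟨j, hj, h₁, h₂⟩ := hS _ hx _ hy i (by simpa using hi)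
  refine ⟨j, by simpa using hj, ?_, ?_⟩
  · show _ + a ∈ S
    convert h₁ using 1
    abel
  · show _ + a ∈ S
    convert h₂ using 1
    abel

lemma box (hS : MConvex S) (p : ι) (l u : ℤ) : MConvex {x | x ∈ S ∧ l ≤ x p ∧ x p ≤ u} := by
  rintro x ⟨hx, hlx, hux⟩ y ⟨hy, hly, huy⟩ i hi
  obtain ⟨j, hj, h₁, h₂⟩ := hS x hx y hy i hi
  refine ⟨j, hj, ⟨h₁, ?_⟩, ⟨h₂, ?_⟩⟩ <;>
    · by_cases hpi : p = i <;> by_cases hpj : p = j <;> simp_all <;> omega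

lemma split (hS : MConvex S) {p q : ι} (hpq : p ≠ q) :
    MConvex {x | x + x p • (Pi.single q 1 - Pi.single p 1) ∈ S} := by
  intro x hx y hy i hi
  simp only [Set.mem_ofPred_eq] at hx hy
  have key : ∀ z : ι → ℤ, ∀ a b : ι, ∀ a' b' : ι, (a' = if a = p then q else a) →
      (b' = if b = p then q else b) →
      (z - Pi.single a 1 + Pi.single b 1) + (z - Pi.single a 1 + Pi.single b 1 : ι → ℤ) p •
        (Pi.single q 1 - Pi.single p 1) =
      (z + z p • (Pi.single q 1 - Pi.single p 1)) - Pi.single a' 1 + Pi.single b' 1 := by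
    intro z a b a' b' ha hb
    subst ha hb
    ext l
    simp only [Pi.add_apply, Pi.sub_apply, Pi.smul_apply, smul_eq_mul, Pi.single_apply]
    grind
  have fin : ∀ a b a' b' : ι, (a' = if a = p then q else a) → (b' = if b = p then q else b) →
      x + x p • (Pi.single q 1 - Pi.single p 1) - Pi.single a' 1 + Pi.single b' 1 ∈ S →
      y + y p • (Pi.single q 1 - Pi.single p 1) + Pi.single a' 1 - Pi.single b' 1 ∈ S →
      x - Pi.single a 1 + Pi.single b 1 ∈ {x | x + x p • (Pi.single q 1 - Pi.single p 1) ∈ S} ∧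
      y + Pi.single a 1 - Pi.single b 1 ∈ {x | x + x p • (Pi.single q 1 - Pi.single p 1) ∈ S} := by
    intro a b a' b' ha hb h₁ h₂
    refine ⟨?_, ?_⟩
    · show _ ∈ S
      rw [key x a b a' b' ha hb]
      exact h₁
    · rw [add_sub_right_comm]
      show _ ∈ S
      rw [key y b a b' a' hb ha, sub_add_eq_add_sub]
      exact h₂
  have hval : ∀ (z : ι → ℤ) (l : ι), (z + z p • (Pi.single q 1 - Pi.single p 1) : ι → ℤ) l =
      if l = p then 0 else if l = q then z q + z p else z l := by
    intro z l
    by_cases h1 : l = p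
    · subst h1; simp [hpq]
    · by_cases h2 : l = q
      · subst h2; simp [h1]
      · simp [h1, h2]
  by_cases hi' : (i = p ∧ x q < y q) ∨ (i = q ∧ x p < y p)
  · have same : x + x p • (Pi.single q 1 - Pi.single p 1) - Pi.single q 1 + Pi.single q 1 ∈ S ∧
        y + y p • (Pi.single q 1 - Pi.single p 1) + Pi.single q 1 - Pi.single q 1 ∈ S := by
      simpa using ⟨hx, hy⟩
    rcases hi' with ⟨rfl, h⟩ | ⟨rfl, h⟩
    · exact ⟨q, h, fin _ _ q q (by simp) (by simp) same.1 same.2⟩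
    · exact ⟨p, h, fin _ _ i i (by simp) (by simp) same.1 same.2⟩
  · push Not at hi'
    obtain ⟨j, hj, h₁, h₂⟩ := hS _ hx _ hy (if i = p then q else i) (by
      rw [hval, hval]
      by_cases h1 : i = p
      · subst h1
        have := hi'.1 rfl
        simp [hpq.symm]; omega
      · by_cases h2 : i = q
        · subst h2
          have := hi'.2 rfl
          simp [h1]; omega
        · simpa [h1, h2] using hi)
    rw [hval, hval] at hj
    by_cases hjp : j = p
    · simp [hjp] at hj
    by_cases hjq : j = q
    · subst hjq
      simp only [hjp, if_false, if_true] at hj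
      rcases lt_or_ge (x j) (y j) with h | h
      · exact ⟨j, h, fin _ _ _ j rfl (by simp [hjp]) h₁ h₂⟩
      · exact ⟨p, by omega, fin _ _ _ j rfl (by simp) h₁ h₂⟩
    · simp only [hjp, hjq, if_false] at hj
      exact ⟨j, hj, fin _ _ _ j rfl (by simp [hjp]) h₁ h₂⟩

lemma union_single (hS : MConvex S) {a b : ι} (hab : a ≠ b) :
    MConvex {x | x - Pi.single a 1 ∈ S ∨ x - Pi.single b 1 ∈ S} := by
  have same : ∀ c, (c = a ∨ c = b) → ∀ x y : ι → ℤ, x - Pi.single c 1 ∈ S →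
      y - Pi.single c 1 ∈ S → ∀ i, y i < x i → ∃ j, x j < y j ∧
      x - Pi.single i 1 + Pi.single j 1 ∈ {x | x - Pi.single a 1 ∈ S ∨ x - Pi.single b 1 ∈ S} ∧
      y + Pi.single i 1 - Pi.single j 1 ∈
        {x | x - Pi.single a 1 ∈ S ∨ x - Pi.single b 1 ∈ S} := by
    intro c hc x y hx hy i hi
    obtain ⟨j, hj, h₁, h₂⟩ := hS _ hx _ hy i (by simpa using hi)
    have h₁' : x - Pi.single i 1 + Pi.single j 1 - Pi.single c 1 ∈ S := by
      convert h₁ using 1; abel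
    have h₂' : y + Pi.single i 1 - Pi.single j 1 - Pi.single c 1 ∈ S := by
      convert h₂ using 1; abel
    refine ⟨j, by simpa using hj, ?_⟩
    rcases hc with rfl | rfl
    · exact ⟨Or.inl h₁', Or.inl h₂'⟩
    · exact ⟨Or.inr h₁', Or.inr h₂'⟩
  have mixed : ∀ a b, a ≠ b → ∀ x y : ι → ℤ,
      (∀ c, (c = a ∨ c = b) → x - Pi.single c 1 ∈ S → y - Pi.single c 1 ∈ S → False) →
      x - Pi.single a 1 ∈ S →
      y - Pi.single b 1 ∈ S → ∀ i, y i < x i → ∃ j, x j < y j ∧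
      (x - Pi.single i 1 + Pi.single j 1 - Pi.single a 1 ∈ S ∨
        x - Pi.single i 1 + Pi.single j 1 - Pi.single b 1 ∈ S) ∧
      (y + Pi.single i 1 - Pi.single j 1 - Pi.single a 1 ∈ S ∨
        y + Pi.single i 1 - Pi.single j 1 - Pi.single b 1 ∈ S) := by
    intro a b hab x y hnot hx hy i hi
    have hba := hab.symm
    by_cases hia : i = a ∧ x a = y a + 1
    · obtain ⟨rfl, hxy⟩ := hia
      rcases lt_or_ge (x b) (y b) with hb | hb
      · refine ⟨b, hb, Or.inr ?_, Or.inl ?_⟩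
        · convert hx using 1; abel
        · convert hy using 1; abel
      · obtain ⟨j, hj, h₁, h₂⟩ := hS _ hx _ hy b (by simp [hba]; omega)
        have hji : j ≠ i := by rintro rfl; simp [hab] at hj; omega
        have hjb : j ≠ b := by rintro rfl; simp [hba] at hj; omega
        refine ⟨j, by simpa [hji, hjb] using hj, Or.inr ?_, Or.inl ?_⟩
        · convert h₁ using 1; abel
        · convert h₂ using 1; abel
    · obtain ⟨j, hj, h₁, h₂⟩ := hS _ hx _ hy i (by
        by_cases h1 : i = a
        · subst h1
          have : x i ≠ y i + 1 := fun h => hia ⟨rfl, h⟩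
          simp [hab]; omega
        · by_cases h2 : i = b
          · subst h2; simp [hba]; omega
          · simpa [h1, h2] using hi)
      by_cases hxj : x j < y j
      · refine ⟨j, hxj, Or.inl ?_, Or.inr ?_⟩
        · convert h₁ using 1; abel
        · convert h₂ using 1; abel
      have hja : j = a := by
        by_contra h
        by_cases h2 : j = b
        · subst h2; simp [hba] at hj; omega
        · simp [h, h2] at hj; omega
      subst hja
      have hxi : x - Pi.single i 1 ∈ S := by
        convert h₁ using 1; abel
      rcases lt_or_ge (x b) (y b) with hb | hb
      · refine ⟨b, hb, Or.inr ?_, Or.inl ?_⟩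
        · convert hxi using 1; abel
        · convert h₂ using 1; abel
      have hib : i ≠ b := by
        rintro rfl
        exact hnot i (Or.inr rfl) hxi hy
      have hij : i ≠ j := by
        rintro rfl
        have : x i ≠ y i + 1 := fun h => hia ⟨rfl, h⟩
        simp [hab] at hj; omega
      obtain ⟨l, hl, h₃, h₄⟩ := hS _ hxi _ h₂ b (by simp [hib.symm, hba]; omega)
      have hlj : l ≠ j := by
        rintro rfl; simp [hab, hij.symm] at hl; omega
      have hlb : l ≠ b := by
        rintro rfl; simp [hba, hib.symm] at hl; omega
      by_cases hli : l = i
      · subst hli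
        exact (hnot b (Or.inr rfl) (by convert h₃ using 1; abel) hy).elim
      · refine ⟨l, by simpa [hlj, hlb, hli] using hl, Or.inr ?_, Or.inl ?_⟩
        · convert h₃ using 1; abel
        · convert h₄ using 1; abel
  intro x hx y hy i hi
  by_cases hc : ∃ c, (c = a ∨ c = b) ∧ x - Pi.single c 1 ∈ S ∧ y - Pi.single c 1 ∈ S
  · obtain ⟨c, hc, h₁, h₂⟩ := hc
    exact same c hc x y h₁ h₂ i hi
  · push Not at hc
    rcases hx with hx | hx <;> rcases hy with hy | hy
    · exact absurd hy (hc a (Or.inl rfl) hx)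
    · exact mixed a b hab x y (fun c h1 h2 h3 => hc c h1 h2 h3) hx hy i hi
    · obtain ⟨j, hj, h₁, h₂⟩ := mixed b a hab.symm x y
        (fun c h1 h2 h3 => hc c h1.symm h2 h3) hx hy i hi
      exact ⟨j, hj, h₁.symm, h₂.symm⟩
    · exact absurd hy (hc b (Or.inr rfl) hx)

variable [Fintype ι]

lemma sum_le_of_closed (hS : MConvex S) {s : ι → ℤ} (hs : s ∈ S) (I : Finset ι)
    (hI : ∀ i ∈ I, ∀ j, s - Pi.single i 1 + Pi.single j 1 ∈ S → j ∈ I) :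
    ∀ y ∈ S, ∑ i ∈ I, s i ≤ ∑ i ∈ I, y i := by
  intro y
  induction h : ∑ i, (s i - y i).toNat using Nat.strong_induction_on generalizing y with
  | _ N ih =>
    intro hy
    by_cases hk : ∃ k ∈ I, y k < s k
    · obtain ⟨k, hkI, hk⟩ := hk
      obtain ⟨j, hj, h₁, h₂⟩ := hS s hs y hy k hk
      have hjk : j ≠ k := by rintro rfl; omega
      have hjI := hI k hkI j h₁
      have := ih (∑ i, (s i - (y + Pi.single k 1 - Pi.single j 1 : ι → ℤ) i).toNat) ?_ _ rfl h₂
      · simpa [Finset.sum_add_distrib, Finset.sum_sub_distrib, hkI, hjI,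
          Finset.sum_pi_single'] using this
      · rw [← h]
        apply Finset.sum_lt_sum
        · intro l _
          by_cases hl : l = j
          · subst hl; simp [hjk]; omega
          · simp only [Pi.sub_apply, Pi.add_apply, Pi.single_apply, hl, if_false]
            split_ifs <;> omega
        · exact ⟨k, Finset.mem_univ _, by simp [hjk.symm]; omega⟩
    · push Not at hk
      exact Finset.sum_le_sum hk

lemma sum_eq (hS : MConvex S) {s y : ι → ℤ} (hs : s ∈ S) (hy : y ∈ S) :
    ∑ i, s i = ∑ i, y i :=
  le_antisymm (hS.sum_le_of_closed hs _ (by simp) y hy) (hS.sum_le_of_closed hy _ (by simp) s hs)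

lemma mem_of_sum_le (hS : MConvex S) (hne : S.Nonempty) {p : ι → ℤ}
    (hp : ∀ I : Finset ι, ∃ s ∈ S, ∑ i ∈ I, s i ≤ ∑ i ∈ I, p i)
    (hsum : ∃ s ∈ S, ∑ i, s i = ∑ i, p i) : p ∈ S := by
  classical
  have hmin : ∃ s ∈ S, ∀ y ∈ S, ∑ i, (s i - p i).toNat ≤ ∑ i, (y i - p i).toNat := by
    obtain ⟨s, hs, h⟩ := (measure fun y : ι → ℤ => ∑ i, (y i - p i).toNat).wf.has_min S hne
    exact ⟨s, hs, fun y hy => not_lt.1 (h y hy)⟩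
  obtain ⟨s, hs, hmin⟩ := hmin
  have hle : ∀ i, s i ≤ p i := by
    by_contra! hcon
    obtain ⟨i, hi⟩ := hcon
    set I : Finset ι := Finset.univ.filter fun j => s - Pi.single i 1 + Pi.single j 1 ∈ S with hI
    have hiI : i ∈ I := by simp [hI, hs]
    have hclosed : ∀ k ∈ I, ∀ j, s - Pi.single k 1 + Pi.single j 1 ∈ S → j ∈ I := by
      intro k hk j hj
      by_cases hki : k = i
      · subst hki; simpa [hI] using hj
      by_cases hji : j = i
      · rwa [hji]
      by_cases hjk : j = k
      · rwa [hjk]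
      have hk' : s - Pi.single i 1 + Pi.single k 1 ∈ S := by simpa [hI] using hk
      obtain ⟨l, hl, h₁, -⟩ := hS _ hj _ hk' i (by
        simp [Ne.symm hki, Ne.symm hji])
      have hlk : l = k := by
        by_contra hlk
        simp only [Pi.sub_apply, Pi.add_apply, Pi.single_apply, hlk, if_false] at hl
        split_ifs at hl <;> omega
      subst hlk
      simp only [hI, Finset.mem_filter, Finset.mem_univ, true_and]
      convert h₁ using 1
      abel
    obtain ⟨y, hy, hyI⟩ := hp I
    have hsI := (hS.sum_le_of_closed hs I hclosed y hy).trans hyI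
    obtain ⟨j, hjI, hj⟩ : ∃ j ∈ I, s j < p j := by
      by_contra! hcon
      exact absurd hsI (not_le.2 (Finset.sum_lt_sum hcon ⟨i, hiI, hi⟩))
    have hij : i ≠ j := by rintro rfl; omega
    refine absurd (hmin _ (by simpa [hI] using hjI :
      s - Pi.single i 1 + Pi.single j 1 ∈ S)) (not_le.2 ?_)
    apply Finset.sum_lt_sum
    · intro l _
      by_cases hl : l = j
      · subst hl; simp [hij.symm]; omega
      · simp only [Pi.sub_apply, Pi.add_apply, Pi.single_apply, hl, if_false]
        split_ifs <;> omega
    · exact ⟨i, Finset.mem_univ _, by simp [hij]; omega⟩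
  obtain ⟨y, hy, hsum⟩ := hsum
  have : s = p := by
    funext i
    have h := (hS.sum_eq hs hy).trans hsum
    exact (Finset.sum_eq_sum_iff_of_le fun i _ => hle i).1 h i (Finset.mem_univ i)
  rwa [← this]

end MConvex

lemma sum_nonneg_of_superlevel_sum_nonneg {ι : Type*} [Fintype ι] (c d : ι → ℝ)
    (h : ∀ t : ℝ, 0 ≤ ∑ i with t < c i, d i) (t : ℝ) :
    0 ≤ ∑ i with t < c i, (c i - t) * d i := by
  classical
  induction hN : (Finset.univ.filter fun i => t < c i).card using Nat.strong_induction_on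
    generalizing t with
  | _ N ih =>
    rcases (Finset.univ.filter fun i => t < c i).eq_empty_or_nonempty with he | hne
    · simp [he]
    obtain ⟨m, hm, hmin⟩ := Finset.exists_min_image _ c hne
    have htm : t < c m := by simpa using hm
    have hsub : (Finset.univ.filter fun i => c m < c i) ⊆ Finset.univ.filter fun i => t < c i := by
      intro i hi
      simp only [Finset.mem_filter, Finset.mem_univ, true_and] at hi ⊢
      exact htm.trans hi
    have hlt := ih _ (by
      rw [← hN]
      apply Finset.card_lt_card
      refine ⟨hsub, fun hcon => ?_⟩
      simpa using hcon hm) (c m) rfl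
    have hsplit : ∑ i with t < c i, (c i - t) * d i =
        (c m - t) * ∑ i with t < c i, d i + ∑ i with c m < c i, (c i - c m) * d i := by
      rw [Finset.sum_subset hsub, Finset.mul_sum, ← Finset.sum_add_distrib]
      · exact Finset.sum_congr rfl fun i _ => by ring
      · intro i hi hi'
        have h1 := hmin i hi
        have h2 : c i ≤ c m := by simpa using hi'
        simp [le_antisymm h2 h1]
    rw [hsplit]
    exact add_nonneg (mul_nonneg (sub_nonneg.2 htm.le) (h t)) hlt

/-- The inclusion of lattice points in a real coordinate space. -/
def latticeCast {ι : Type*} (x : ι → ℤ) : ι → ℝ := fun i => (x i : ℝ)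

lemma isLinearMap_sum {ι : Type*} (I : Finset ι) : IsLinearMap ℝ fun x : ι → ℝ => ∑ i ∈ I, x i where
  map_add x y := by simp [Finset.sum_add_distrib]
  map_smul c x := by simp [Finset.mul_sum]

lemma exists_linear_minimizer {ι : Type*} [Fintype ι] {S : Set (ι → ℤ)} (hfin : S.Finite)
    (hne : S.Nonempty) (c : ι → ℝ) :
    ∃ s ∈ S, ∀ y ∈ S, ∑ i, c i * s i ≤ ∑ i, c i * y i :=
  Set.exists_min_image S (fun y => ∑ i, c i * (y i : ℝ)) hfin hne

namespace MConvex

variable {ι : Type*} [DecidableEq ι] [Fintype ι] {S : Set (ι → ℤ)}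

lemma sum_eq_of_mem_convexHull (hS : MConvex S) {s : ι → ℤ} (hs : s ∈ S) {p : ι → ℝ}
    (hp : p ∈ convexHull ℝ (latticeCast '' S)) : ∑ i, p i = ∑ i, (s i : ℝ) := by
  refine convexHull_min ?_ (convex_hyperplane (isLinearMap_sum Finset.univ) _) hp
  rintro _ ⟨y, hy, rfl⟩
  have := hS.sum_eq hy hs
  simp only [Set.mem_ofPred_eq, latticeCast]
  exact_mod_cast this

lemma mem_of_latticeCast_mem_convexHull (hS : MConvex S) {p : ι → ℤ}
    (hp : latticeCast p ∈ convexHull ℝ (latticeCast '' S)) : p ∈ S := by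
  have hne : S.Nonempty := by
    simpa using convexHull_nonempty_iff.1 ⟨_, hp⟩
  refine hS.mem_of_sum_le hne (fun I => ?_) ?_
  · by_contra! hcon
    have := convexHull_min (t := {x : ι → ℝ | ∑ i ∈ I, (p i : ℝ) < ∑ i ∈ I, x i}) ?_
      (convex_halfSpace_gt (isLinearMap_sum I) _) hp
    · simp [latticeCast] at this
    · rintro _ ⟨y, hy, rfl⟩
      have := hcon y hy
      simp only [Set.mem_ofPred_eq, latticeCast]
      exact_mod_cast this
  · obtain ⟨s, hs⟩ := hne
    have := hS.sum_eq_of_mem_convexHull hs hp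
    refine ⟨s, hs, ?_⟩
    simp only [latticeCast] at this
    exact_mod_cast this.symm

lemma superlevel_sum_le (hS : MConvex S) {s : ι → ℤ} (hs : s ∈ S) {c : ι → ℝ}
    (hmin : ∀ y ∈ S, ∑ i, c i * s i ≤ ∑ i, c i * y i) (t : ℝ) :
    ∀ y ∈ S, ∑ i with t < c i, s i ≤ ∑ i with t < c i, y i := by
  refine hS.sum_le_of_closed hs _ fun i hi j hj => ?_
  simp only [Finset.mem_filter, Finset.mem_univ, true_and] at hi ⊢
  have h := hmin _ hj
  simp only [Pi.add_apply, Pi.sub_apply, Int.cast_add, Int.cast_sub, mul_add, mul_sub,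
    Finset.sum_add_distrib, Finset.sum_sub_distrib] at h
  simp [Pi.single_apply] at h
  linarith

end MConvex

lemma MConvex.isGenPermutahedron {N : ℕ} {S : Set (Fin N → ℤ)} (hS : MConvex S)
    (hfin : S.Finite) (hne : S.Nonempty) :
    IsGenPermutahedron (convexHull ℝ (latticeCast '' S)) := by
  have hmin : ∀ I : Finset (Fin N), ∃ s ∈ S, ∀ y ∈ S, ∑ i ∈ I, s i ≤ ∑ i ∈ I, y i := fun I =>
    Set.exists_min_image S (fun y => ∑ i ∈ I, y i) hfin hne
  choose s hs hsmin using hmin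
  refine ⟨fun I => ((∑ i ∈ I, s I i : ℤ) : ℝ), by simp, fun I J => ?_, ?_⟩
  · obtain ⟨u, hu, humin⟩ := exists_linear_minimizer hfin hne
      (fun i => (if i ∈ I then 1 else 0) + (if i ∈ J then 1 else 0))
    have hlevel := hS.superlevel_sum_le hu humin
    have hunion : (Finset.univ.filter fun i => (0 : ℝ) <
        (if i ∈ I then 1 else 0) + (if i ∈ J then 1 else 0)) = I ∪ J := by
      ext i
      by_cases h1 : i ∈ I <;> by_cases h2 : i ∈ J <;> simp [h1, h2]
    have hinter : (Finset.univ.filter fun i => (1 : ℝ) <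
        (if i ∈ I then 1 else 0) + (if i ∈ J then 1 else 0)) = I ∩ J := by
      ext i
      by_cases h1 : i ∈ I <;> by_cases h2 : i ∈ J <;> simp [h1, h2]
    have h0 := hlevel 0 _ (hs (I ∪ J))
    have h1 := hlevel 1 _ (hs (I ∩ J))
    rw [hunion] at h0
    rw [hinter] at h1
    have h2 := hsmin I u hu
    have h3 := hsmin J u hu
    have h4 := Finset.sum_union_inter (s₁ := I) (s₂ := J) (f := u)
    beta_reduce
    norm_cast
    linarith
  · beta_reduce
    apply Set.Subset.antisymm
    · intro x hx
      refine ⟨fun I _ => ?_, ?_⟩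
      · refine convexHull_min ?_ (convex_halfSpace_ge (isLinearMap_sum I) _) hx
        rintro _ ⟨y, hy, rfl⟩
        simp only [Set.mem_ofPred_eq, latticeCast]
        exact_mod_cast hsmin I y hy
      · have := hS.sum_eq_of_mem_convexHull (hs Finset.univ) hx
        exact_mod_cast this
    · rintro x ⟨hx, hxu⟩
      by_contra hcon
      obtain ⟨f, u, hfx, hfu⟩ := geometric_hahn_banach_point_closed (convex_convexHull ℝ _)
        ((hfin.image latticeCast).isClosed_convexHull ℝ) hcon
      set c : Fin N → ℝ := fun i => f (Pi.single i 1) with hc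
      have hf : ∀ y : Fin N → ℝ, f y = ∑ i, c i * y i := fun y => by
        have := LinearMap.pi_apply_eq_sum_univ (f : (Fin N → ℝ) →ₗ[ℝ] ℝ) y
        simp only [ContinuousLinearMap.coe_coe, smul_eq_mul] at this
        rw [this]
        refine Finset.sum_congr rfl fun i _ => ?_
        rw [mul_comm, hc]
        congr 2
        ext j
        simp [Pi.single_apply, eq_comm]
      obtain ⟨v, hv, hvmin⟩ := exists_linear_minimizer hfin hne c
      have hvf := hfu _ (subset_convexHull ℝ _ ⟨v, hv, rfl⟩)
      have hall : ∀ I : Finset (Fin N), ((∑ i ∈ I, s I i : ℤ) : ℝ) ≤ ∑ i ∈ I, x i := by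
        intro I
        by_cases hI : I = Finset.univ
        · rw [hI, hxu]
        · exact hx I hI
      have hlev : ∀ t : ℝ, 0 ≤ ∑ i with t < c i, (x i - v i) := by
        intro t
        have h1 := hS.superlevel_sum_le hv hvmin t _ (hs (Finset.univ.filter fun i => t < c i))
        have h2 := hall (Finset.univ.filter fun i => t < c i)
        have h3 : ((∑ i with t < c i, v i : ℤ) : ℝ) ≤
          ((∑ i with t < c i, s (Finset.univ.filter fun i => t < c i) i : ℤ) : ℝ) := by
          exact_mod_cast h1
        rw [Finset.sum_sub_distrib]
        push_cast at *
        linarith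
      obtain ⟨t, ht⟩ : ∃ t, ∀ i, t < c i := by
        obtain ⟨t, ht⟩ := (Set.finite_range c).bddBelow
        exact ⟨t - 1, fun i => by linarith [ht ⟨i, rfl⟩]⟩
      have hfinal := sum_nonneg_of_superlevel_sum_nonneg c _ hlev t
      have hsum : ∑ i, (x i - v i) = 0 := by
        rw [Finset.sum_sub_distrib, hxu, hS.sum_eq (hs Finset.univ) hv]
        push_cast
        ring
      simp only [ht, Finset.filter_true, sub_mul, mul_sub] at hfinal
      rw [hf] at hfx hvf
      simp only [Finset.sum_sub_distrib, ← Finset.mul_sum] at hfinal hsum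
      simp only [latticeCast] at hvf
      have : t * ∑ i, x i = t * ∑ i, (v i : ℝ) := by rw [sub_eq_zero.1 hsum]
      linarith

section Homogenization

variable {N : ℕ}

/-- An exponent vector as an integer vector. -/
def exponentVec (d : Fin N →₀ ℕ) : Fin N → ℤ := fun i => (d i : ℤ)

lemma exponentVec_injective : Function.Injective (exponentVec (N := N)) := fun d e h =>
  Finsupp.ext fun i => by simpa [exponentVec] using congrFun h i

/-- Append to an integer vector a coordinate that makes the coordinate sum zero. -/
def balance {R : Type*} [AddCommGroup R] (x : Fin N → R) : Option (Fin N) → R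
  | none => -∑ i, x i
  | some i => x i

lemma balance_injective {R : Type*} [AddCommGroup R] :
    Function.Injective (balance (N := N) (R := R)) := fun _ _ h =>
  funext fun i => congrFun h (some i)

/-- The exponent vectors of a polynomial, homogenized by an extra coordinate. -/
def balancedSupport (f : MvPolynomial (Fin N) ℤ) : Set (Option (Fin N) → ℤ) :=
  (fun d => balance (exponentVec d)) '' (f.support : Set (Fin N →₀ ℕ))

lemma newtonPolytope_eq (f : MvPolynomial (Fin N) ℤ) :
    newtonPolytope f =
      convexHull ℝ (latticeCast '' (exponentVec '' (f.support : Set (Fin N →₀ ℕ)))) := by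
  unfold newtonPolytope
  congr 1
  ext v
  simp only [Set.mem_image, Set.mem_ofPred_eq, exists_exists_and_eq_and, eq_comm (a := v)]
  rfl

lemma latticeCast_exponentVec (α : Fin N →₀ ℕ) :
    latticeCast (exponentVec α) = fun i => ((α i : ℕ) : ℝ) := by
  ext i
  simp [latticeCast, exponentVec]

lemma coeff_ne_zero_mem_newtonPolytope {f : MvPolynomial (Fin N) ℤ} {α : Fin N →₀ ℕ}
    (h : coeff α f ≠ 0) : (fun i => ((α i : ℕ) : ℝ)) ∈ newtonPolytope f :=
  subset_convexHull ℝ _ ⟨α, mem_support_iff.2 h, rfl⟩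

lemma hasPolytopalSupport_of_mConvex {f : MvPolynomial (Fin N) ℤ}
    (hf : MConvex (exponentVec '' (f.support : Set (Fin N →₀ ℕ)))) : HasPolytopalSupport f := by
  refine fun α => ⟨fun h => ?_, coeff_ne_zero_mem_newtonPolytope⟩
  rw [newtonPolytope_eq, ← latticeCast_exponentVec] at h
  obtain ⟨d, hd, hdα⟩ := hf.mem_of_latticeCast_mem_convexHull h
  rw [← exponentVec_injective hdα]
  exact mem_support_iff.1 hd

/-- `balance` on real vectors as a linear map. -/
def balanceLinear : (Fin N → ℝ) →ₗ[ℝ] (Option (Fin N) → ℝ) where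
  toFun := balance
  map_add' x y := by
    ext (_ | i) <;> simp [balance, Finset.sum_add_distrib, add_comm]
  map_smul' c x := by
    ext (_ | i) <;> simp [balance, Finset.mul_sum]

lemma balance_latticeCast (x : Fin N → ℤ) :
    balance (latticeCast x) = latticeCast (balance x) := by
  ext (_ | i) <;> simp [balance, latticeCast]

lemma hasPolytopalSupport_of_mConvex_balancedSupport {f : MvPolynomial (Fin N) ℤ}
    (hf : MConvex (balancedSupport f)) : HasPolytopalSupport f := by
  refine fun α => ⟨fun h => ?_, coeff_ne_zero_mem_newtonPolytope⟩
  rw [newtonPolytope_eq, ← latticeCast_exponentVec] at h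
  have h' := Set.mem_image_of_mem balanceLinear h
  rw [LinearMap.image_convexHull] at h'
  have himage : balanceLinear '' (latticeCast '' (exponentVec '' (f.support : Set (Fin N →₀ ℕ)))) =
      latticeCast '' balancedSupport f := by
    simp only [balancedSupport, Set.image_image]
    exact Set.image_congr fun d _ => balance_latticeCast _
  rw [himage] at h'
  replace h' : balance (latticeCast (exponentVec α)) ∈
    convexHull ℝ (latticeCast '' balancedSupport f) := h'
  rw [balance_latticeCast] at h'
  obtain ⟨d, hd, hdα⟩ := hf.mem_of_latticeCast_mem_convexHull h'
  rw [← exponentVec_injective (balance_injective hdα)]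
  exact mem_support_iff.1 hd

lemma balance_exchange (x : Fin N → ℤ) (i j : Fin N) :
    balance (x - Pi.single i 1 + Pi.single j 1) =
      balance x - Pi.single (some i) 1 + Pi.single (some j) 1 := by
  ext (_ | l) <;> simp [balance, Finset.sum_add_distrib, Finset.sum_sub_distrib, Pi.single_apply]

lemma mConvex_homogeneousComponent {f : MvPolynomial (Fin N) ℤ}
    (hf : MConvex (balancedSupport f)) (k : ℕ) :
    MConvex (exponentVec '' ((homogeneousComponent k f).support : Set (Fin N →₀ ℕ))) := by
  have hmem : ∀ x : Fin N → ℤ,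
      x ∈ exponentVec '' ((homogeneousComponent k f).support : Set (Fin N →₀ ℕ)) ↔
      balance x ∈ balancedSupport f ∧ ∑ i, x i = k := by
    intro x
    have hdeg : ∀ d : Fin N →₀ ℕ, d.degree = k ↔ ∑ i, exponentVec d i = k := fun d => by
      rw [Finsupp.degree_eq_sum]
      simp only [exponentVec]
      exact_mod_cast Iff.rfl
    constructor
    · rintro ⟨d, hd, rfl⟩
      simp only [Finset.mem_coe, mem_support_iff, coeff_homogeneousComponent, ne_eq,
        ite_eq_right_iff, Classical.not_imp] at hd
      exact ⟨⟨d, mem_support_iff.2 hd.2, rfl⟩, (hdeg d).1 hd.1⟩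
    · rintro ⟨⟨d, hd, hdx⟩, hk⟩
      obtain rfl := balance_injective hdx
      refine ⟨d, ?_, rfl⟩
      simp only [Finset.mem_coe, mem_support_iff, coeff_homogeneousComponent, ne_eq,
        ite_eq_right_iff, Classical.not_imp]
      exact ⟨(hdeg d).2 hk, mem_support_iff.1 hd⟩
  intro x hx y hy i hi
  rw [hmem] at hx hy
  obtain ⟨j, hj, h₁, h₂⟩ := hf _ hx.1 _ hy.1 (some i) hi
  rcases j with _ | j
  · simp [balance, hx.2, hy.2] at hj
  refine ⟨j, hj, ?_, ?_⟩
  · rw [hmem, balance_exchange]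
    exact ⟨h₁, by simp [Finset.sum_add_distrib, Finset.sum_sub_distrib, hx.2]⟩
  · rw [hmem, add_sub_right_comm, balance_exchange, sub_add_eq_add_sub]
    exact ⟨h₂, by simp [Finset.sum_add_distrib, Finset.sum_sub_distrib, hy.2]⟩

lemma isGenPermutahedron_homogeneousComponent {f : MvPolynomial (Fin N) ℤ}
    (hf : MConvex (balancedSupport f)) (k : ℕ) (hne : homogeneousComponent k f ≠ 0) :
    IsGenPermutahedron (newtonPolytope (homogeneousComponent k f)) := by
  rw [newtonPolytope_eq]
  exact (mConvex_homogeneousComponent hf k).isGenPermutahedron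
    ((Finset.finite_toSet _).image _) ((Finset.coe_nonempty.2 (support_nonempty.2 hne)).image _)

end Homogenization

section SignAlternating

variable {σ : Type*}

/-- The coefficients of `f` have signs that alternate with the degree. -/
def SignAlternating (s : ℕ) (f : MvPolynomial σ ℤ) : Prop :=
  ∀ d : σ →₀ ℕ, 0 ≤ (-1) ^ (s + d.degree) * coeff d f

lemma SignAlternating.sum {κ : Type*} {I : Finset κ} {g : κ → MvPolynomial σ ℤ} {s : ℕ}
    (h : ∀ t ∈ I, SignAlternating s (g t)) : SignAlternating s (∑ t ∈ I, g t) := by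
  intro d
  rw [coeff_sum, Finset.mul_sum]
  exact Finset.sum_nonneg fun t ht => h t ht d

lemma SignAlternating.coeff_sum_ne_zero {κ : Type*} {I : Finset κ} {g : κ → MvPolynomial σ ℤ}
    {s : ℕ} (h : ∀ t ∈ I, SignAlternating s (g t)) (d : σ →₀ ℕ) :
    coeff d (∑ t ∈ I, g t) ≠ 0 ↔ ∃ t ∈ I, coeff d (g t) ≠ 0 := by
  have hsign : ((-1 : ℤ) ^ (s + d.degree)) ≠ 0 := by simp
  have hzero : coeff d (∑ t ∈ I, g t) = 0 ↔ ∀ t ∈ I, coeff d (g t) = 0 := by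
    rw [← mul_right_inj' hsign, mul_zero, coeff_sum, Finset.mul_sum,
      Finset.sum_eq_zero_iff_of_nonneg fun t ht => h t ht d]
    simp
  rw [ne_eq, hzero]
  push Not
  rfl

lemma signAlternating_monomial {s : ℕ} {e : σ →₀ ℕ} {c : ℤ}
    (h : 0 ≤ (-1) ^ (s + e.degree) * c) : SignAlternating s (monomial e c) := by
  classical
  intro d
  rw [coeff_monomial]
  split_ifs with hd
  · rwa [← hd]
  · simp

end SignAlternating

lemma sub_mul_sum_Icc_pow {R : Type*} [CommRing R] (x y : R) {b m : ℕ} (hb : b ≤ m + 1) :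
    (x - y) * ∑ i ∈ Finset.Icc b m, x ^ i * y ^ (m + b - i) =
      x ^ (m + 1) * y ^ b - x ^ b * y ^ (m + 1) := by
  obtain ⟨r, hr⟩ := Nat.exists_eq_add_of_le hb
  have hIcc : Finset.Icc b m = Finset.Ico b (m + 1) := by
    ext i
    simp only [Finset.mem_Icc, Finset.mem_Ico]
    omega
  have hsum : ∑ i ∈ Finset.Icc b m, x ^ i * y ^ (m + b - i) =
      (x * y) ^ b * ∑ i ∈ Finset.range r, x ^ i * y ^ (r - 1 - i) := by
    rw [hIcc, Finset.sum_Ico_eq_sum_range, hr, Nat.add_sub_cancel_left, Finset.mul_sum]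
    refine Finset.sum_congr rfl fun i hi => ?_
    have hi' := Finset.mem_range.1 hi
    rw [show m + b - (b + i) = b + (r - 1 - i) by omega, pow_add, pow_add, mul_pow]
    ring
  have hgeom := Commute.geom_sum₂_mul (Commute.all x y) r
  rw [hsum, mul_left_comm, mul_comm (x - y), hgeom, hr, pow_add, pow_add, mul_pow]
  ring

section IsobaricStep

variable {N : ℕ} (p q : Fin N) (m : ℕ)

/-- The exponent vectors of the monomials of the image of `x ^ d` under `isobaricStep`. -/
def stepExponent (d : Fin N →₀ ℕ) (ε i : ℕ) : Fin N →₀ ℕ :=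
  d.erase q + Finsupp.single p i + Finsupp.single q (m + (d q + ε) - i)

/-- The polynomial `∂ ((1 - x_q) x_p ^ (m + 1) f)`, with `∂` the divided difference in `x_p` and
`x_q`, for `f` not involving `x_p` and of degree at most `m` in `x_q`. -/
def isobaricStep (f : MvPolynomial (Fin N) ℤ) : MvPolynomial (Fin N) ℤ :=
  ∑ d ∈ f.support, ∑ ε ∈ Finset.range 2, ∑ i ∈ Finset.Icc (d q + ε) m,
    monomial (stepExponent p q m d ε i) ((-1) ^ ε * coeff d f)

variable {p q m} {f : MvPolynomial (Fin N) ℤ}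

lemma rename_swap_monomial_of_eq_zero {d : Fin N →₀ ℕ} (hp : d p = 0) (hq : d q = 0) (c : ℤ) :
    rename (Equiv.swap p q) (monomial d c) = monomial d c := by
  rw [rename_monomial]
  refine congrArg (fun d => monomial d c) (Finsupp.ext fun i => ?_)
  rw [← Finsupp.equivMapDomain_eq_mapDomain, Finsupp.equivMapDomain_apply, Equiv.symm_swap]
  rcases eq_or_ne i p with rfl | h1
  · rw [Equiv.swap_apply_left, hp, hq]
  rcases eq_or_ne i q with rfl | h2
  · rw [Equiv.swap_apply_right, hp, hq]
  rw [Equiv.swap_apply_of_ne_of_ne h1 h2]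

lemma sub_mul_isobaricStep (hpq : p ≠ q) (hf : ∀ d ∈ f.support, d p = 0 ∧ d q ≤ m) :
    (X p - X q) * isobaricStep p q m f =
      (1 - X q) * (X p ^ (m + 1) * f) -
        rename (Equiv.swap p q) ((1 - X q) * (X p ^ (m + 1) * f)) := by
  conv_rhs => rw [f.as_sum]
  simp only [isobaricStep, Finset.mul_sum, map_sum, ← Finset.sum_sub_distrib]
  refine Finset.sum_congr rfl fun d hd => ?_
  obtain ⟨hdp, hdq⟩ := hf d hd
  set M : MvPolynomial (Fin N) ℤ := monomial (d.erase q) (coeff d f) with hM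
  have hren : rename (Equiv.swap p q) M = M :=
    rename_swap_monomial_of_eq_zero (by simp [Finsupp.erase_ne hpq, hdp]) (by simp) _
  have hmon : monomial d (coeff d f) = M * X q ^ d q := by
    rw [hM, X_pow_eq_monomial, monomial_mul, mul_one, Finsupp.erase_add_single]
  have hterm : ∀ ε i, monomial (stepExponent p q m d ε i) ((-1) ^ ε * coeff d f) =
      (-1) ^ ε * M * (X p ^ i * X q ^ (m + (d q + ε) - i)) := by
    intro ε i
    rw [hM, X_pow_eq_monomial, X_pow_eq_monomial, monomial_mul, mul_assoc, monomial_mul,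
      stepExponent, ← C_mul_monomial]
    simp [add_assoc]
  have hinner : ∀ ε, d q + ε ≤ m + 1 → ∑ i ∈ Finset.Icc (d q + ε) m,
      (X p - X q) * monomial (stepExponent p q m d ε i) ((-1) ^ ε * coeff d f) =
      (-1) ^ ε * M * (X p ^ (m + 1) * X q ^ (d q + ε) - X p ^ (d q + ε) * X q ^ (m + 1)) := by
    intro ε hε
    rw [← sub_mul_sum_Icc_pow _ _ hε, Finset.mul_sum, Finset.mul_sum]
    refine Finset.sum_congr rfl fun i _ => ?_
    rw [hterm]
    ring
  rw [Finset.sum_range_succ, Finset.sum_range_one, hinner 0 (by omega), hinner 1 (by omega), hmon]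
  simp only [map_mul, map_sub, map_one, map_pow, rename_X, hren, Equiv.swap_apply_left,
    Equiv.swap_apply_right]
  ring

lemma degree_stepExponent {d : Fin N →₀ ℕ} {ε i : ℕ} (hi : i ≤ m) :
    (stepExponent p q m d ε i).degree = d.degree + m + ε := by
  have h : d.degree = (d.erase q).degree + d q := by
    conv_lhs => rw [← Finsupp.erase_add_single q d]
    rw [map_add, Finsupp.degree_single]
  rw [stepExponent, map_add, map_add, Finsupp.degree_single, Finsupp.degree_single, h]
  omega

lemma signAlternating_step_term {s : ℕ} (hs : SignAlternating s f) (d : Fin N →₀ ℕ) {ε i : ℕ}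
    (hi : i ≤ m) : SignAlternating (s + m)
      (monomial (stepExponent p q m d ε i) ((-1) ^ ε * coeff d f)) := by
  apply signAlternating_monomial
  rw [degree_stepExponent hi]
  have h := hs d
  have h2 : (-1 : ℤ) ^ (s + m + (d.degree + m + ε)) * ((-1) ^ ε * coeff d f) =
      ((-1) ^ m * (-1) ^ m) * ((-1) ^ ε * (-1) ^ ε) * ((-1) ^ (s + d.degree) * coeff d f) := by
    ring
  rw [h2, ← mul_pow, ← mul_pow]
  simpa using h

lemma signAlternating_isobaricStep {s : ℕ} (hs : SignAlternating s f) :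
    SignAlternating (s + m) (isobaricStep p q m f) :=
  SignAlternating.sum fun d _ => SignAlternating.sum fun _ _ => SignAlternating.sum fun _ hi =>
    signAlternating_step_term hs d (Finset.mem_Icc.1 hi).2

lemma mem_support_isobaricStep (hpq : p ≠ q) {s : ℕ} (hs : SignAlternating s f)
    (hf : ∀ d ∈ f.support, d p = 0 ∧ d q ≤ m) (e : Fin N →₀ ℕ) :
    e ∈ (isobaricStep p q m f).support ↔ (e p ≤ m ∧ e q ≤ m) ∧ ∃ d ∈ f.support, ∃ ε : ℕ, ε < 2 ∧
      exponentVec e = exponentVec d + (e p : ℤ) • Pi.single p 1 +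
        ((m : ℤ) + ε - e p) • Pi.single q 1 := by
  rw [mem_support_iff, isobaricStep, SignAlternating.coeff_sum_ne_zero (s := s + m) fun d _ =>
    SignAlternating.sum fun _ _ => SignAlternating.sum fun _ hi =>
    signAlternating_step_term hs d (Finset.mem_Icc.1 hi).2]
  have hterm : ∀ d, coeff e (∑ ε ∈ Finset.range 2, ∑ i ∈ Finset.Icc (d q + ε) m,
      monomial (stepExponent p q m d ε i) ((-1) ^ ε * coeff d f)) ≠ 0 ↔
      ∃ ε ∈ Finset.range 2, ∃ i ∈ Finset.Icc (d q + ε) m,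
        coeff e (monomial (stepExponent p q m d ε i) ((-1) ^ ε * coeff d f)) ≠ 0 := by
    intro d
    rw [SignAlternating.coeff_sum_ne_zero (s := s + m) fun _ _ => SignAlternating.sum fun _ hi =>
      signAlternating_step_term hs d (Finset.mem_Icc.1 hi).2]
    refine exists_congr fun ε => and_congr_right fun _ => ?_
    rw [SignAlternating.coeff_sum_ne_zero (s := s + m) fun _ hi =>
      signAlternating_step_term hs d (Finset.mem_Icc.1 hi).2]
  simp only [hterm, coeff_monomial, Finset.mem_range, Finset.mem_Icc]
  have hqp := hpq.symm
  constructor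
  · rintro ⟨d, hd, ε, hε, i, ⟨hi₁, hi₂⟩, hne⟩
    obtain ⟨hdp, hdq⟩ := hf d hd
    have he : stepExponent p q m d ε i = e := by
      by_contra h
      simp [h] at hne
    have hep : e p = i := by
      rw [← he]; simp [stepExponent, Finsupp.erase_ne hpq, hdp, hpq]
    have heq : e q = m + (d q + ε) - i := by
      rw [← he]; simp [stepExponent, hqp]
    refine ⟨⟨by omega, by omega⟩, d, hd, ε, hε, ?_⟩
    ext l
    rcases eq_or_ne l p with rfl | h1
    · simp [exponentVec, hpq, hdp]
    rcases eq_or_ne l q with rfl | h2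
    · simp [exponentVec, hqp, heq, hep]; omega
    · have hel : e l = d l := by
        rw [← he]; simp [stepExponent, Finsupp.erase_ne h2, h1, h2]
      simp [exponentVec, h1, h2, hel]
  · rintro ⟨⟨hep, heq⟩, d, hd, ε, hε, h⟩
    obtain ⟨hdp, hdq⟩ := hf d hd
    have hq := congrFun h q
    simp [exponentVec, hqp] at hq
    refine ⟨d, hd, ε, hε, e p, ⟨by omega, hep⟩, ?_⟩
    have he : stepExponent p q m d ε (e p) = e := by
      ext l
      rcases eq_or_ne l p with rfl | h1
      · simp [stepExponent, Finsupp.erase_ne hpq, hdp, hpq]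
      rcases eq_or_ne l q with rfl | h2
      · simp [stepExponent, hqp]; omega
      · have hl := congrFun h l
        simp [exponentVec, h1, h2] at hl
        simp [stepExponent, Finsupp.erase_ne h2, h1, h2, hl]
    rw [if_pos he]
    simpa using mem_support_iff.1 hd

lemma balance_add_smul_single (x : Fin N → ℤ) (a b : ℤ) :
    balance (x + a • Pi.single p 1 + b • Pi.single q 1) =
      balance x + a • (Pi.single (some p) 1 - Pi.single none 1) +
        b • (Pi.single (some q) 1 - Pi.single none 1) := by
  ext (_ | l) <;>
    simp [balance, Finset.sum_add_distrib, Pi.single_apply]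
  ring

lemma mConvex_balancedSupport_isobaricStep (hpq : p ≠ q) {s : ℕ} (hs : SignAlternating s f)
    (hf : ∀ d ∈ f.support, d p = 0 ∧ d q ≤ m) (hconv : MConvex (balancedSupport f)) :
    MConvex (balancedSupport (isobaricStep p q m f)) := by
  have hconv' := (((((hconv.union_single (Option.some_ne_none q).symm).translate
    (((m : ℤ) + 1) • Pi.single none 1 - (m : ℤ) • Pi.single (some q) 1)).split
    (fun h => hpq (Option.some_injective _ h))).box (some p) 0 m).box (some q) 0 m)
  convert hconv' using 1
  ext x
  simp only [Set.mem_ofPred_eq]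
  constructor
  · rintro ⟨e, he, rfl⟩
    obtain ⟨⟨hep, heq⟩, d, hd, ε, hε, h⟩ := (mem_support_isobaricStep hpq hs hf e).1 he
    refine ⟨⟨?_, ?_⟩, ?_⟩
    · have hbal : balance (exponentVec e) (some p) = (e p : ℤ) := rfl
      simp only [hbal]
      rw [h, balance_add_smul_single]
      interval_cases ε
      · refine Or.inl ⟨d, hd, ?_⟩
        push_cast
        module
      · refine Or.inr ⟨d, hd, ?_⟩
        push_cast
        module
    · simpa [balance, exponentVec] using hep
    · simpa [balance, exponentVec] using heq
  · rintro ⟨⟨hx, hxp⟩, hxq⟩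
    obtain ⟨d, hd, ε, hε, hdx⟩ : ∃ d ∈ f.support, ∃ ε : ℕ, ε < 2 ∧ x =
        balance (exponentVec d + (x (some p)) • Pi.single p 1 +
          ((m : ℤ) + (ε : ℕ) - x (some p)) • Pi.single q 1) := by
      rcases hx with ⟨d, hd, hx⟩ | ⟨d, hd, hx⟩
      · refine ⟨d, hd, 0, by norm_num, ?_⟩
        rw [balance_add_smul_single]
        simp only at hx
        rw [hx]
        push_cast
        module
      · refine ⟨d, hd, 1, by norm_num, ?_⟩
        rw [balance_add_smul_single]
        simp only at hx
        rw [hx]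
        push_cast
        module
    set w := exponentVec d + (x (some p)) • Pi.single p 1 +
          ((m : ℤ) + (ε : ℕ) - x (some p)) • Pi.single q 1 with hw
    have hxw : ∀ l, x (some l) = w l := fun l => congrFun hdx (some l)
    have hnonneg : ∀ l, 0 ≤ w l := by
      intro l
      rcases eq_or_ne l p with rfl | h1
      · rw [← hxw]; exact hxp.1
      rcases eq_or_ne l q with rfl | h2
      · rw [← hxw]; exact hxq.1
      · simp [hw, exponentVec, h1, h2]
    have hew : exponentVec (Finsupp.equivFunOnFinite.symm fun l => (w l).toNat) = w := by
      ext l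
      simp [exponentVec, hnonneg l]
    refine ⟨Finsupp.equivFunOnFinite.symm fun l => (w l).toNat, ?_,
      (congrArg balance hew).trans hdx.symm⟩
    rw [Finset.mem_coe, mem_support_isobaricStep hpq hs hf, hew]
    simp only [Finsupp.equivFunOnFinite_symm_apply_apply]
    rw [← hxw, ← hxw]
    refine ⟨⟨by omega, by omega⟩, d, hd, ε, hε, ?_⟩
    rw [Int.toNat_of_nonneg hxp.1]

end IsobaricStep

section LehmerCode

variable {n : ℕ}

/-- The Lehmer code of a permutation. -/
def lehmerCode (w : Equiv.Perm (Fin (n + 1))) (i : Fin (n + 1)) : ℕ :=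
  (Finset.univ.filter fun j => i < j ∧ w j < w i).card

lemma lehmerCode_le (w : Equiv.Perm (Fin (n + 1))) (i : Fin (n + 1)) : lehmerCode w i ≤ n + 1 :=
  (Finset.card_le_univ _).trans (by simp)

lemma lehmerCode_revPerm (i : Fin (n + 1)) : lehmerCode Fin.revPerm i = n - (i : ℕ) := by
  have h : (Finset.univ.filter fun j => i < j ∧ Fin.revPerm j < Fin.revPerm i) = Finset.Ioi i := by
    ext j
    simp
  rw [lehmerCode, h, Fin.card_Ioi]
  omega

lemma lehmerCode_last (w : Equiv.Perm (Fin (n + 1))) : lehmerCode w (Fin.last n) = 0 := by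
  simp [lehmerCode, Fin.not_lt.2 (Fin.le_last _)]

variable (w : Equiv.Perm (Fin (n + 1))) (i : Fin n)

lemma castSucc_lt_iff_of_ne_succ {l : Fin (n + 1)} (h : l ≠ i.succ) :
    i.castSucc < l ↔ i.succ < l := by
  simp only [Fin.lt_def, ne_eq, Fin.ext_iff, Fin.val_succ, Fin.val_castSucc] at *
  omega

lemma lehmerCode_mul_swap_castSucc (h : w i.castSucc < w i.succ) :
    lehmerCode (w * Equiv.swap i.castSucc i.succ) i.castSucc = lehmerCode w i.succ + 1 := by
  have hins : (Finset.univ.filter fun j => i.castSucc < j ∧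
      (w * Equiv.swap i.castSucc i.succ) j < (w * Equiv.swap i.castSucc i.succ) i.castSucc) =
      insert i.succ (Finset.univ.filter fun j => i.succ < j ∧ w j < w i.succ) := by
    ext l
    rcases eq_or_ne l i.succ with rfl | h1
    · simp [h]
    rcases eq_or_ne l i.castSucc with rfl | h2
    · simp [h1, (Fin.castSucc_lt_succ (i := i)).le]
    simp [h1, Equiv.swap_apply_of_ne_of_ne h2 h1, castSucc_lt_iff_of_ne_succ i h1]
  rw [lehmerCode, hins, Finset.card_insert_of_notMem (by simp), lehmerCode]

lemma lehmerCode_mul_swap_succ (h : w i.castSucc < w i.succ) :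
    lehmerCode (w * Equiv.swap i.castSucc i.succ) i.succ = lehmerCode w i.castSucc := by
  unfold lehmerCode
  congr 1
  ext l
  rcases eq_or_ne l i.succ with rfl | h1
  · simp [h.le]
  rcases eq_or_ne l i.castSucc with rfl | h2
  · simp [(Fin.castSucc_lt_succ (i := i)).le]
  simp [Equiv.swap_apply_of_ne_of_ne h2 h1, castSucc_lt_iff_of_ne_succ i h1]

lemma lehmerCode_mul_swap_of_ne {j : Fin (n + 1)} (h1 : j ≠ i.castSucc) (h2 : j ≠ i.succ) :
    lehmerCode (w * Equiv.swap i.castSucc i.succ) j = lehmerCode w j := by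
  refine Finset.card_equiv (Equiv.swap i.castSucc i.succ) fun l => ?_
  have hlt : j < l ↔ j < Equiv.swap i.castSucc i.succ l := by
    rcases eq_or_ne l i.castSucc with rfl | h3
    · rw [Equiv.swap_apply_left]
      simp only [Fin.lt_def, ne_eq, Fin.ext_iff, Fin.val_succ, Fin.val_castSucc] at *
      omega
    rcases eq_or_ne l i.succ with rfl | h4
    · rw [Equiv.swap_apply_right]
      simp only [Fin.lt_def, ne_eq, Fin.ext_iff, Fin.val_succ, Fin.val_castSucc] at *
      omega
    rw [Equiv.swap_apply_of_ne_of_ne h3 h4]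
  simp [Equiv.swap_apply_of_ne_of_ne h1 h2, hlt]

variable {w i}

lemma lehmerCode_castSucc_le_of_lt (h : w i.castSucc < w i.succ) :
    lehmerCode w i.castSucc ≤ lehmerCode w i.succ := by
  refine Finset.card_le_card fun l hl => ?_
  simp only [Finset.mem_filter, Finset.mem_univ, true_and] at hl ⊢
  have hne : l ≠ i.succ := by
    rintro rfl
    exact absurd hl.2 h.le.not_gt
  exact ⟨(castSucc_lt_iff_of_ne_succ i hne).1 hl.1, hl.2.trans h⟩

lemma lehmerCode_succ_lt_of_lt (h : w i.succ < w i.castSucc) :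
    lehmerCode w i.succ < lehmerCode w i.castSucc := by
  refine Finset.card_lt_card ⟨fun l hl => ?_, fun hcon => ?_⟩
  · simp only [Finset.mem_filter, Finset.mem_univ, true_and] at hl ⊢
    exact ⟨Fin.castSucc_lt_succ.trans hl.1, hl.2.trans h⟩
  · have : i.succ ∈ Finset.univ.filter fun j => i.succ < j ∧ w j < w i.succ :=
      hcon (by simp [h])
    simp at this

lemma eq_revPerm_of_forall_succ_le (h : ∀ i : Fin n, w i.succ ≤ w i.castSucc) :
    w = Fin.revPerm := by
  have hanti : StrictAnti w := Fin.strictAnti_iff_succ_lt.2 fun i =>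
    lt_of_le_of_ne (h i) fun he => (Fin.castSucc_lt_succ (i := i)).ne' (w.injective he)
  have hmono : StrictMono (Fin.rev ∘ w) := fun a b hab => Fin.rev_lt_rev.2 (hanti hab)
  have hid := (hmono.range_inj strictMono_id).1 (by
    rw [(Fin.rev_surjective.comp w.surjective).range_eq, Set.range_id])
  ext1 l
  have := congrFun hid l
  simp only [Function.comp_apply, id] at this
  rw [Fin.revPerm_apply, ← Fin.rev_rev (w l), this]

lemma antitone_lehmerCode_of_avoids (h : ∀ a b c, a < b → b < c → ¬(w a < w c ∧ w c < w b)) :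
    Antitone (lehmerCode w) := by
  refine Fin.antitone_iff_succ_le.2 fun i => Finset.card_le_card fun l hl => ?_
  simp only [Finset.mem_filter, Finset.mem_univ, true_and] at hl ⊢
  refine ⟨Fin.castSucc_lt_succ.trans hl.1, ?_⟩
  by_contra hcon
  have hne : w i.castSucc ≠ w l := fun he =>
    (Fin.castSucc_lt_succ.trans hl.1).ne (w.injective he)
  exact h _ _ _ Fin.castSucc_lt_succ hl.1 ⟨lt_of_le_of_ne (not_lt.1 hcon) hne, hl.2⟩

end LehmerCode

lemma rename_swap_prod_X_pow {σ : Type*} [DecidableEq σ] (I : Finset σ) (c : σ → ℕ) (a b : σ)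
    (hI : a ∈ I ↔ b ∈ I) (hc : a ∈ I → c a = c b) :
    rename (Equiv.swap a b) (∏ i ∈ I, X i ^ c i : MvPolynomial σ ℤ) = ∏ i ∈ I, X i ^ c i := by
  rw [map_prod]
  refine Finset.prod_equiv (Equiv.swap a b) (fun i => ?_) fun i hi => ?_
  · rcases eq_or_ne i a with rfl | h1
    · simpa using hI
    rcases eq_or_ne i b with rfl | h2
    · simpa using hI.symm
    rw [Equiv.swap_apply_of_ne_of_ne h1 h2]
  · rw [map_pow, rename_X]
    congr 1
    rcases eq_or_ne i a with rfl | h1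
    · simpa using hc hi
    rcases eq_or_ne i b with rfl | h2
    · simpa using (hc (hI.2 hi)).symm
    rw [Equiv.swap_apply_of_ne_of_ne h1 h2]

lemma X_sub_X_ne_zero {σ : Type*} {a b : σ} (h : a ≠ b) :
    (X a - X b : MvPolynomial σ ℤ) ≠ 0 :=
  sub_ne_zero.2 fun he => h (X_injective he)

namespace IsGrothendieckFamily

variable {n : ℕ} {Gr : Equiv.Perm (Fin (n + 1)) → MvPolynomial (Fin (n + 1)) ℤ}

theorem eq_prod_of_antitone_lehmerCode (hGr : IsGrothendieckFamily n Gr)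
    (w : Equiv.Perm (Fin (n + 1))) (hw : Antitone (lehmerCode w)) :
    Gr w = ∏ i, X i ^ lehmerCode w i := by
  induction hN : (n + 1) * (n + 1) - ∑ i, lehmerCode w i using Nat.strong_induction_on
    generalizing w with
  | _ N ih =>
    by_cases hasc : ∃ i : Fin n, w i.castSucc < w i.succ
    · obtain ⟨i, hi, hmin⟩ := (wellFounded_lt (α := Fin n)).has_min
        {i | w i.castSucc < w i.succ} hasc
      replace hi : w i.castSucc < w i.succ := hi
      have hne : i.castSucc ≠ i.succ := Fin.castSucc_lt_succ.ne
      have heq : lehmerCode w i.castSucc = lehmerCode w i.succ :=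
        le_antisymm (lehmerCode_castSucc_le_of_lt hi) (hw Fin.castSucc_lt_succ.le)
      have hcode : ∀ j, lehmerCode (w * Equiv.swap i.castSucc i.succ) j =
          lehmerCode w j + if j = i.castSucc then 1 else 0 := by
        intro j
        rcases eq_or_ne j i.castSucc with rfl | h1
        · rw [lehmerCode_mul_swap_castSucc w i hi, if_pos rfl, heq]
        rcases eq_or_ne j i.succ with rfl | h2
        · rw [lehmerCode_mul_swap_succ w i hi, if_neg h1, heq, add_zero]
        rw [lehmerCode_mul_swap_of_ne w i h1 h2, if_neg h1, add_zero]
      have hanti : Antitone (lehmerCode (w * Equiv.swap i.castSucc i.succ)) := by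
        refine Fin.antitone_iff_succ_le.2 fun k => ?_
        rw [hcode, hcode]
        by_cases hk : k.succ = i.castSucc
        · have hki : k < i := by
            simp only [Fin.ext_iff, Fin.val_succ, Fin.val_castSucc] at hk
            simp only [Fin.lt_def]
            omega
          have hdesc : w k.succ < w k.castSucc :=
            lt_of_le_of_ne (not_lt.1 fun h => hmin k h hki)
              fun he => (Fin.castSucc_lt_succ (i := k)).ne' (w.injective he)
          have := lehmerCode_succ_lt_of_lt hdesc
          rw [if_pos hk]
          omega
        · rw [if_neg hk]
          exact (hw Fin.castSucc_lt_succ.le).trans (Nat.le_add_right _ _)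
      have hbound : ∑ j, lehmerCode (w * Equiv.swap i.castSucc i.succ) j ≤ (n + 1) * (n + 1) := by
        simpa using Finset.sum_le_card_nsmul Finset.univ _ (n + 1) fun j _ =>
          lehmerCode_le (w * Equiv.swap i.castSucc i.succ) j
      have hsum : ∑ j, lehmerCode (w * Equiv.swap i.castSucc i.succ) j =
          ∑ j, lehmerCode w j + 1 := by
        simp [hcode, Finset.sum_add_distrib]
      have hprev := ih _ (by omega) _ hanti rfl
      have hprod : ∏ j, (X j : MvPolynomial (Fin (n + 1)) ℤ) ^
          lehmerCode (w * Equiv.swap i.castSucc i.succ) j =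
          X i.castSucc * ∏ j, X j ^ lehmerCode w j := by
        simp only [hcode, pow_add, Finset.prod_mul_distrib, pow_ite, pow_one, pow_zero,
          Finset.prod_ite_eq', Finset.mem_univ, if_true, mul_comm]
      have hrec := hGr.2 w i hi
      rw [hprev, hprod] at hrec
      refine mul_left_cancel₀ (X_sub_X_ne_zero hne) (hrec.trans ?_)
      simp only [map_mul, map_sub, map_one, rename_X, Equiv.swap_apply_left,
        Equiv.swap_apply_right]
      rw [rename_swap_prod_X_pow _ _ _ _ (by simp) fun _ => heq]
      ring
    · push Not at hasc
      rw [eq_revPerm_of_forall_succ_le hasc, hGr.1]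
      simp only [lehmerCode_revPerm]

theorem exists_mConvex_factor (hGr : IsGrothendieckFamily n Gr)
    (v : Equiv.Perm (Fin (n + 1))) (hv : Antitone (lehmerCode v)) (hlast : v (Fin.last n) = 0)
    (k : Fin (n + 1)) (w : Equiv.Perm (Fin (n + 1))) (hlt : ∀ i < k, w i = v i) (hk : w k = 0)
    (hgt : ∀ i : Fin n, k ≤ i.castSucc → w i.succ = v i.castSucc) :
    ∃ (f : MvPolynomial (Fin (n + 1)) ℤ) (s : ℕ),
      Gr w = (∏ i ∈ Finset.Iio k, X i ^ lehmerCode v i) * f ∧ SignAlternating s f ∧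
      MConvex (balancedSupport f) ∧
      ∀ d ∈ f.support, (∀ i < k, d i = 0) ∧ d k ≤ lehmerCode v k - 1 := by
  induction k using Fin.reverseInduction generalizing w with
  | last =>
    have hwv : w = v := by
      ext1 l
      rcases eq_or_ne l (Fin.last n) with rfl | h
      · rw [hk, hlast]
      · exact hlt l (lt_of_le_of_ne (Fin.le_last l) h)
    refine ⟨1, 0, ?_, ?_, ?_, ?_⟩
    · rw [hwv, hGr.eq_prod_of_antitone_lehmerCode v hv, mul_one]
      refine (Finset.prod_subset (Finset.subset_univ _) fun l _ hl => ?_).symm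
      have : l = Fin.last n := by
        by_contra h
        exact hl (Finset.mem_Iio.2 (lt_of_le_of_ne (Fin.le_last l) h))
      rw [this, lehmerCode_last, pow_zero]
    · change SignAlternating 0 (monomial 0 1)
      exact signAlternating_monomial (by simp)
    · rintro _ ⟨d, hd, rfl⟩ _ ⟨e, he, rfl⟩ i hi
      simp only [support_one, Finset.coe_singleton, Set.mem_singleton_iff] at hd he
      subst hd he
      exact absurd hi (lt_irrefl _)
    · intro d hd
      simp only [support_one, Finset.mem_singleton] at hd
      simp [hd]
  | cast j ih =>
    have hne : j.castSucc ≠ j.succ := Fin.castSucc_lt_succ.ne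
    have hpos : w j.castSucc < w j.succ := by
      rw [hk]
      refine Fin.pos_iff_ne_zero.2 fun h => hne (w.injective (hk.trans h.symm))
    obtain ⟨f, s, hf, hsign, hconv, hsupp⟩ := ih (w * Equiv.swap j.castSucc j.succ)
      (fun i hi => by
        rcases eq_or_ne i j.castSucc with rfl | h
        · simpa using hgt j le_rfl
        · have hij : i < j.castSucc := lt_of_le_of_ne (Fin.le_castSucc_iff.2 hi) h
          rw [Equiv.Perm.mul_apply, Equiv.swap_apply_of_ne_of_ne h hi.ne, hlt i hij])
      (by simpa using hk)
      (fun i hi => by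
        have hji : j.castSucc < i.castSucc := Fin.castSucc_lt_succ.trans_le hi
        have hji' : j < i := hji
        rw [Equiv.Perm.mul_apply, Equiv.swap_apply_of_ne_of_ne
          (hji.trans Fin.castSucc_lt_succ).ne' (Fin.succ_lt_succ_iff.2 hji').ne', hgt i hji.le])
    have hcode : 1 ≤ lehmerCode v j.castSucc := by
      refine Finset.card_pos.2 ⟨Fin.last n, ?_⟩
      simp only [Finset.mem_filter, Finset.mem_univ, true_and, Fin.castSucc_lt_last, hlast]
      refine Fin.pos_iff_ne_zero.2 fun h => (Fin.castSucc_lt_last j).ne (v.injective ?_)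
      rw [h, hlast]
    obtain ⟨m, hm⟩ := Nat.exists_eq_add_of_le' hcode
    have hdeg : ∀ d ∈ f.support, d j.castSucc = 0 ∧ d j.succ ≤ m := by
      intro d hd
      refine ⟨(hsupp d hd).1 _ Fin.castSucc_lt_succ, (hsupp d hd).2.trans ?_⟩
      have := hv (Fin.castSucc_lt_succ (i := j)).le
      omega
    refine ⟨isobaricStep j.castSucc j.succ m f, s + m, ?_, signAlternating_isobaricStep hsign,
      mConvex_balancedSupport_isobaricStep hne hsign hdeg hconv, ?_⟩
    · have hIio : Finset.Iio j.succ = insert j.castSucc (Finset.Iio j.castSucc) := by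
        ext l
        simp only [Finset.mem_Iio, Finset.mem_insert, Fin.lt_def, Fin.ext_iff, Fin.val_succ,
          Fin.val_castSucc]
        omega
      have hren := rename_swap_prod_X_pow (Finset.Iio j.castSucc) (lehmerCode v) j.castSucc j.succ
        (by simp [Fin.castSucc_lt_succ.le]) (by simp)
      have hrec := hGr.2 w j hpos
      have hstep := sub_mul_isobaricStep (f := f) hne hdeg
      rw [hf, hIio, Finset.prod_insert (by simp), hm] at hrec
      refine mul_left_cancel₀ (X_sub_X_ne_zero hne) (hrec.trans ?_)
      rw [mul_left_comm (X j.castSucc - X j.succ), hstep]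
      simp only [map_mul, map_sub, map_one, map_pow, rename_X, hren]
      ring
    · intro e he
      obtain ⟨⟨hep, -⟩, d, hd, ε, -, h⟩ := (mem_support_isobaricStep hne hsign hdeg e).1 he
      refine ⟨fun i hi => ?_, by omega⟩
      have hei := congrFun h i
      have hi' : i < j.succ := hi.trans Fin.castSucc_lt_succ
      simpa [exponentVec, hi.ne, hi'.ne, (hsupp d hd).1 i hi'] using hei

theorem mConvex_balancedSupport (hGr : IsGrothendieckFamily n Gr)
    (π : Equiv.Perm (Fin (n + 1))) (hfix : π 0 = 0)
    (hdom : ∀ a b c : Fin (n + 1), 0 < a → a < b → b < c → ¬(π a < π c ∧ π c < π b)) :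
    MConvex (balancedSupport (Gr π)) := by
  set v : Equiv.Perm (Fin (n + 1)) := π * finRotate (n + 1) with hv
  have hcast : ∀ i : Fin n, v i.castSucc = π i.succ := fun i => by
    rw [hv, Equiv.Perm.mul_apply, finRotate_apply, Fin.coeSucc_eq_succ]
  have hlast : v (Fin.last n) = 0 := by
    rw [hv, Equiv.Perm.mul_apply, finRotate_last, hfix]
  have hanti : Antitone (lehmerCode v) := by
    refine antitone_lehmerCode_of_avoids fun a b c hab hbc h => ?_
    have hc : c ≠ Fin.last n := by
      rintro rfl
      rw [hlast] at h
      exact Fin.not_lt_zero _ h.1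
    have hclt := lt_of_le_of_ne (Fin.le_last c) hc
    obtain ⟨c, rfl⟩ := Fin.exists_castSucc_eq.2 hc
    obtain ⟨b, rfl⟩ := Fin.exists_castSucc_eq.2 (hbc.trans hclt).ne
    obtain ⟨a, rfl⟩ := Fin.exists_castSucc_eq.2 (hab.trans (hbc.trans hclt)).ne
    rw [hcast, hcast, hcast] at h
    exact hdom _ _ _ (Fin.succ_pos a) (Fin.succ_lt_succ_iff.2 hab) (Fin.succ_lt_succ_iff.2 hbc) h
  obtain ⟨f, -, hf, -, hconv, -⟩ := hGr.exists_mConvex_factor v hanti hlast 0 π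
    (fun i hi => absurd hi (Fin.not_lt_zero i)) hfix fun i _ => (hcast i).symm
  have hempty : Finset.Iio (0 : Fin (n + 1)) = ∅ := by
    ext l
    simp
  rw [hempty, Finset.prod_empty, one_mul] at hf
  rwa [hf]

end IsGrothendieckFamily

/-- Theorem C, Grothendieck part.  Let `π = 1π' ∈ S_{n+1}` with `π'` a
dominant (132-avoiding) permutation of `{2,…,n+1}`.  Then the Grothendieck polynomial
`𝔊_π` has polytopal support, and for every `k ≥ 0` the homogeneous component of `𝔊_π` of
degree `ℓ(π) + k` has polytopal support, and its Newton polytope is a generalized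
permutahedron whenever this component is nonzero. -/
theorem grothendieck_dominant_case (n : ℕ)
    (Gr : Equiv.Perm (Fin (n + 1)) → MvPolynomial (Fin (n + 1)) ℤ)
    (hGr : IsGrothendieckFamily n Gr) (π : Equiv.Perm (Fin (n + 1)))
    (hfix : π 0 = 0)
    (hdom : ∀ a b c : Fin (n + 1), 0 < a → a < b → b < c → ¬(π a < π c ∧ π c < π b)) :
    HasPolytopalSupport (Gr π) ∧
    ∀ k : ℕ,
      HasPolytopalSupport (homogeneousComponent (invCount n π + k) (Gr π)) ∧
      (homogeneousComponent (invCount n π + k) (Gr π) ≠ 0 →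
        IsGenPermutahedron
          (newtonPolytope (homogeneousComponent (invCount n π + k) (Gr π)))) := by
  have hconv := hGr.mConvex_balancedSupport π hfix hdom
  exact ⟨hasPolytopalSupport_of_mConvex_balancedSupport hconv, fun k =>
    ⟨hasPolytopalSupport_of_mConvex (mConvex_homogeneousComponent hconv _),
      isGenPermutahedron_homogeneousComponent hconv _⟩⟩
end
end
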